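/- There exists a universal constant C > 0 such that for every weighted graph G = (V,E,w) on n vertices, every parameter 0 < ρ < 1, and every priority ranking v_1, v_2, …, v_n of V, there exists a spanner H of G with lightness Ψ(H) ≤ 1 + C·ρ and prioritized distortion α, where α(j) = (C/ρ) · log(j+2) · (1 + log(1 + log(j+2)))². -/

import Mathlib

open Finset

attribute [local instance] Classical.propDecidable

section Defs

variable {V : Type*} [Fintype V]

/-- Total weight of a (sub)graph: the sum of its edge weights. -/
noncomputable def wWeight (H : SimpleGraph V) (w : Sym2 V → ℝ) : ℝ :=
  ∑ e ∈ H.edgeSet.toFinite.toFinset, w e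

/-- Shortest-path distance in a weighted graph: infimum of walk weights. -/
noncomputable def wdist (G : SimpleGraph V) (w : Sym2 V → ℝ) (u v : V) : ℝ :=
  sInf {x : ℝ | ∃ p : G.Walk u v, x = (p.edges.map w).sum}

/-- `T` is a spanning tree of `G`. -/
def IsSpanningTree (G T : SimpleGraph V) : Prop :=
  T ≤ G ∧ T.IsTree

/-- Weight of a minimum spanning tree of `G`. -/
noncomputable def mstWeight (G : SimpleGraph V) (w : Sym2 V → ℝ) : ℝ :=
  sInf {x : ℝ | ∃ T : SimpleGraph V, IsSpanningTree G T ∧ x = wWeight T w}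

/-- `T` is a minimum spanning tree of `G`. -/
def IsMST (G : SimpleGraph V) (w : Sym2 V → ℝ) (T : SimpleGraph V) : Prop :=
  IsSpanningTree G T ∧ ∀ T' : SimpleGraph V, IsSpanningTree G T' → wWeight T w ≤ wWeight T' w

/-- A spanner of `G`: a connected spanning subgraph. -/
def IsSpanner (G H : SimpleGraph V) : Prop := H ≤ G ∧ H.Connected

/-- `G` together with `w` is a weighted graph: connected, positive pairwise-distinct
edge weights. -/
def IsWeightedGraph (G : SimpleGraph V) (w : Sym2 V → ℝ) : Prop :=
  G.Connected ∧ (∀ e ∈ G.edgeSet, 0 < w e) ∧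
    (∀ e ∈ G.edgeSet, ∀ e' ∈ G.edgeSet, e ≠ e' → w e ≠ w e')

/-- The ordered pairs of distinct vertices whose distortion in `H` is at most `t`. -/
noncomputable def goodPairs (G H : SimpleGraph V) (w : Sym2 V → ℝ) (t : ℝ) : Finset (V × V) :=
  Finset.univ.offDiag.filter (fun p => wdist H w p.1 p.2 ≤ t * wdist G w p.1 p.2)

/-- Scaling distortion `γ`: for every `ε ∈ (0,1)`, at least a `(1-ε)` fraction of the
pairs of distinct vertices have distortion at most `γ ε`.  (Counted over ordered pairs:
`n·(n-1) = 2·(n choose 2)`.) -/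
def HasScalingDistortion (G H : SimpleGraph V) (w : Sym2 V → ℝ) (γ : ℝ → ℝ) : Prop :=
  ∀ ε : ℝ, 0 < ε → ε < 1 →
    (1 - ε) * ((Fintype.card V : ℝ) * ((Fintype.card V : ℝ) - 1)) ≤
      ((goodPairs G H w (γ ε)).card : ℝ)

/-- The `ℓ_q`-distortion of the spanner `H` of `G`. -/
noncomputable def distq (G H : SimpleGraph V) (w : Sym2 V → ℝ) (q : ℝ) : ℝ :=
  ((∑ p ∈ (Finset.univ : Finset V).offDiag, (wdist H w p.1 p.2 / wdist G w p.1 p.2) ^ q) /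
    ((Fintype.card V : ℝ) * ((Fintype.card V : ℝ) - 1))) ^ (1 / q)

/-- `R(v,ε)`: the minimal radius `r` such that the ball `B(v,r)` contains at least `εn`
vertices. -/
noncomputable def Rgraph (G : SimpleGraph V) (w : Sym2 V → ℝ) (v : V) (ε : ℝ) : ℝ :=
  sInf {r : ℝ | 0 ≤ r ∧
    ε * (Fintype.card V : ℝ) ≤ ((Finset.univ.filter (fun u => wdist G w u v ≤ r)).card : ℝ)}

/-- Coarse scaling distortion `γ`: every pair of distinct vertices that are mutually
`ε/2`-far has distortion at most `γ ε`. -/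
def HasCoarseScalingDistortion (G H : SimpleGraph V) (w : Sym2 V → ℝ) (γ : ℝ → ℝ) : Prop :=
  ∀ ε : ℝ, 0 < ε → ε < 1 → ∀ u v : V, u ≠ v →
    Rgraph G w v (ε / 2) ≤ wdist G w u v → Rgraph G w u (ε / 2) ≤ wdist G w u v →
    wdist H w u v ≤ γ ε * wdist G w u v

end Defs

/-- A finite multigraph with unit-length base links (a symmetric relation) and further
links indexed by `ι`, each with two endpoints and a length at least one. -/
structure LinkSystem (α ι : Type*) where
  base : α → α → Prop
  base_symm : ∀ x y, base x y → base y x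
  src : ι → α
  dst : ι → α
  len : ι → ℝ
  one_le_len : ∀ e, 1 ≤ len e

namespace LinkSystem

variable {α ι : Type*}

/-- `P.Near F x y r`: some walk from `x` to `y` through base links and links in `F` has
length at most `r`. -/
inductive Near (P : LinkSystem α ι) (F : Finset ι) (x : α) : α → ℝ → Prop
  | refl (r : ℝ) : 0 ≤ r → Near P F x x r
  | base (y z : α) (r r' : ℝ) : Near P F x y r → P.base y z → r + 1 ≤ r' → Near P F x z r'
  | fwd (e : ι) (r r' : ℝ) : Near P F x (P.src e) r → e ∈ F → r + P.len e ≤ r' →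
      Near P F x (P.dst e) r'
  | bwd (e : ι) (r r' : ℝ) : Near P F x (P.dst e) r → e ∈ F → r + P.len e ≤ r' →
      Near P F x (P.src e) r'

variable {P : LinkSystem α ι} {F F' : Finset ι} {x y z : α} {r r' : ℝ}

lemma Near.nonneg (h : P.Near F x y r) : 0 ≤ r := by
  induction h with
  | refl r h => exact h
  | base y z r r' _ _ h ih => linarith
  | fwd e r r' _ _ h ih => linarith [P.one_le_len e]
  | bwd e r r' _ _ h ih => linarith [P.one_le_len e]

lemma Near.mono (h : P.Near F x y r) (hF : F ⊆ F') (hr : r ≤ r') : P.Near F' x y r' := by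
  induction h generalizing r' with
  | refl r h => exact .refl _ (h.trans hr)
  | base y z r s _ hb h ih => exact .base y z r _ (ih le_rfl) hb (h.trans hr)
  | fwd e r s _ hb h ih => exact .fwd e r _ (ih le_rfl) (hF hb) (h.trans hr)
  | bwd e r s _ hb h ih => exact .bwd e r _ (ih le_rfl) (hF hb) (h.trans hr)

lemma Near.trans (h : P.Near F x y r) (h' : P.Near F y z r') : P.Near F x z (r + r') := by
  induction h' with
  | refl s hs => exact h.mono subset_rfl (by linarith)
  | base y z s s' _ hb hs ih => exact .base y z _ _ ih hb (by linarith)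
  | fwd e s s' _ hb hs ih => exact .fwd e _ _ ih hb (by linarith)
  | bwd e s s' _ hb hs ih => exact .bwd e _ _ ih hb (by linarith)

lemma near_base (h : P.base x y) : P.Near F x y 1 :=
  .base x y 0 1 (.refl 0 le_rfl) h (by norm_num)

lemma near_fwd {e : ι} (h : e ∈ F) : P.Near F (P.src e) (P.dst e) (P.len e) :=
  .fwd e 0 _ (.refl 0 le_rfl) h (by simp)

lemma near_bwd {e : ι} (h : e ∈ F) : P.Near F (P.dst e) (P.src e) (P.len e) :=
  .bwd e 0 _ (.refl 0 le_rfl) h (by simp)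

lemma Near.symm (h : P.Near F x y r) : P.Near F y x r := by
  induction h with
  | refl r h => exact .refl _ h
  | base y z s s' _ hb hs ih =>
    exact ((near_base (P.base_symm _ _ hb)).trans ih).mono subset_rfl (by linarith)
  | fwd e s s' _ hb hs ih => exact ((near_bwd hb).trans ih).mono subset_rfl (by linarith)
  | bwd e s s' _ hb hs ih => exact ((near_fwd hb).trans ih).mono subset_rfl (by linarith)

/-- A walk using one additional link either avoids it, or crosses it exactly once. -/
lemma Near.of_insert {e : ι} (h : P.Near (insert e F) x y r) :
    P.Near F x y r ∨ ∃ a b, a + b + P.len e ≤ r ∧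
      ((P.Near F x (P.src e) a ∧ P.Near F (P.dst e) y b) ∨
        (P.Near F x (P.dst e) a ∧ P.Near F (P.src e) y b)) := by
  induction h with
  | refl r h => exact .inl (.refl _ h)
  | base y z s s' _ hb hs ih =>
    rcases ih with ih | ⟨a, b, hab, ih⟩
    · exact .inl (.base y z _ _ ih hb hs)
    · refine .inr ⟨a, b + 1, by linarith, ?_⟩
      rcases ih with ⟨h1, h2⟩ | ⟨h1, h2⟩
      · exact .inl ⟨h1, .base y z _ _ h2 hb le_rfl⟩
      · exact .inr ⟨h1, .base y z _ _ h2 hb le_rfl⟩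
  | fwd f s s' _ hb hs ih =>
    rcases Finset.mem_insert.1 hb with rfl | hf
    · rcases ih with ih | ⟨a, b, hab, ⟨h1, h2⟩ | ⟨h1, h2⟩⟩
      · exact .inr ⟨s, 0, by linarith, .inl ⟨ih, .refl _ le_rfl⟩⟩
      · exact .inr ⟨a, 0, by linarith [h2.nonneg, P.one_le_len f], .inl ⟨h1, .refl _ le_rfl⟩⟩
      · exact .inl (h1.mono subset_rfl (by linarith [h2.nonneg, P.one_le_len f]))
    · rcases ih with ih | ⟨a, b, hab, ih⟩
      · exact .inl (.fwd f _ _ ih hf hs)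
      · refine .inr ⟨a, b + P.len f, by linarith, ?_⟩
        rcases ih with ⟨h1, h2⟩ | ⟨h1, h2⟩
        · exact .inl ⟨h1, .fwd f _ _ h2 hf le_rfl⟩
        · exact .inr ⟨h1, .fwd f _ _ h2 hf le_rfl⟩
  | bwd f s s' _ hb hs ih =>
    rcases Finset.mem_insert.1 hb with rfl | hf
    · rcases ih with ih | ⟨a, b, hab, ⟨h1, h2⟩ | ⟨h1, h2⟩⟩
      · exact .inr ⟨s, 0, by linarith, .inr ⟨ih, .refl _ le_rfl⟩⟩
      · exact .inl (h1.mono subset_rfl (by linarith [h2.nonneg, P.one_le_len f]))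
      · exact .inr ⟨a, 0, by linarith [h2.nonneg, P.one_le_len f], .inr ⟨h1, .refl _ le_rfl⟩⟩
    · rcases ih with ih | ⟨a, b, hab, ih⟩
      · exact .inl (.bwd f _ _ ih hf hs)
      · refine .inr ⟨a, b + P.len f, by linarith, ?_⟩
        rcases ih with ⟨h1, h2⟩ | ⟨h1, h2⟩
        · exact .inl ⟨h1, .bwd f _ _ h2 hf le_rfl⟩
        · exact .inr ⟨h1, .bwd f _ _ h2 hf le_rfl⟩

/-- The greedy spanner: every link is approximated within a factor `t`, and no chosen link
can be replaced by a walk that is `t - 1` times as long. -/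
lemma exists_greedy [Fintype ι] (P : LinkSystem α ι) {t : ℝ} (ht : 1 ≤ t) :
    ∃ E : Finset ι, (∀ c, P.Near E (P.src c) (P.dst c) (t * P.len c)) ∧
      ∀ e ∈ E, ¬ P.Near (E.erase e) (P.src e) (P.dst e) ((t - 1) * P.len e) := by
  suffices h : ∀ S : Finset ι, ∃ E ⊆ S,
      (∀ c ∈ S, P.Near E (P.src c) (P.dst c) (t * P.len c)) ∧
      ∀ e ∈ E, ¬ P.Near (E.erase e) (P.src e) (P.dst e) ((t - 1) * P.len e) by
    obtain ⟨E, -, h1, h2⟩ := h univ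
    exact ⟨E, fun c => h1 c (mem_univ c), h2⟩
  intro S
  induction S using Finset.induction_on_max_value P.len with
  | empty => exact ⟨∅, by simp, by simp, by simp⟩
  | insert a s ha hmax ih =>
    obtain ⟨E, hEs, h1, h2⟩ := ih
    by_cases hn : P.Near E (P.src a) (P.dst a) (t * P.len a)
    · refine ⟨E, hEs.trans (subset_insert _ _), ?_, h2⟩
      intro c hc
      rcases mem_insert.1 hc with rfl | hc
      · exact hn
      · exact h1 c hc
    · have haE : a ∉ E := fun h => ha (hEs h)
      refine ⟨insert a E, insert_subset_insert _ hEs, ?_, ?_⟩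
      · intro c hc
        rcases mem_insert.1 hc with rfl | hc
        · exact (near_fwd (mem_insert_self _ _)).mono subset_rfl
            (by nlinarith [P.one_le_len c])
        · exact (h1 c hc).mono (subset_insert _ _) le_rfl
      · intro e he hcon
        rcases mem_insert.1 he with rfl | he
        · rw [erase_insert haE] at hcon
          exact hn (hcon.mono subset_rfl (by nlinarith [P.one_le_len e]))
        · have hne : a ≠ e := fun h => haE (h ▸ he)
          rw [erase_insert_of_ne hne] at hcon
          have hle := hmax e (hEs he)
          have hte : t * P.len e ≤ t * P.len a :=
            mul_le_mul_of_nonneg_left hle (by linarith)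
          have hla := P.one_le_len a
          rcases hcon.of_insert with h | ⟨p, q, hpq, ⟨h3, h4⟩ | ⟨h3, h4⟩⟩
          · exact h2 e he h
          · have h3' := h3.mono (erase_subset _ _) (le_refl p)
            have h4' := h4.mono (erase_subset _ _) (le_refl q)
            exact hn ((h3'.symm.trans ((near_fwd he).trans h4'.symm)).mono subset_rfl
              (by nlinarith))
          · have h3' := h3.mono (erase_subset _ _) (le_refl p)
            have h4' := h4.mono (erase_subset _ _) (le_refl q)
            exact hn ((h4'.trans ((near_bwd he).trans h3')).mono subset_rfl
              (by nlinarith))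

/-- A set separating two points joined by base links has a base link on its boundary. -/
lemma Near.exists_boundary (h : P.Near ∅ x y r) {S : Set α} (hx : x ∈ S) (hy : y ∉ S) :
    ∃ a b, a ∈ S ∧ b ∉ S ∧ P.base a b := by
  induction h with
  | refl r h => exact absurd hx hy
  | base y z s s' _ hb hs ih =>
    by_cases hyS : y ∈ S
    · exact ⟨y, z, hyS, hy, hb⟩
    · exact ih hyS
  | fwd e s s' _ hb hs ih => simp at hb
  | bwd e s s' _ hb hs ih => simp at hb

end LinkSystem

namespace LinkSystem

variable {α ι : Type*}

/-- The link system of a finite multigraph: no base links, all links of length one. -/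
def unit (u v : ι → α) : LinkSystem α ι where
  base _ _ := False
  base_symm _ _ h := h
  src := u
  dst := v
  len _ := 1
  one_le_len _ := le_rfl

lemma Near.eq_of_lt_one {P : LinkSystem α ι} {F : Finset ι} {x y : α} {r : ℝ}
    (h : P.Near F x y r) (hr : r < 1) : x = y := by
  cases h with
  | refl r h => rfl
  | base y z s s' h hb hs => linarith [h.nonneg]
  | fwd e s s' h hb hs => linarith [h.nonneg, P.one_le_len e]
  | bwd e s s' h hb hs => linarith [h.nonneg, P.one_le_len e]

lemma unit_near_symm_ends {u v : ι → α} {N : Finset ι} {e : ι} (he : e ∈ N) :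
    (unit u v).Near N (u e) (v e) 1 ∧ (unit u v).Near N (v e) (u e) 1 :=
  ⟨near_fwd (P := unit u v) he, near_bwd (P := unit u v) he⟩

/-- A walk from `p` whose length is at most a lower bound for the distance of one end of
`e` does not need `e`, except possibly for reaching that end itself. -/
lemma unit_avoid {u v : ι → α} {N : Finset ι} {e : ι} (he : e ∈ N) {p x y z : α} {k : ℕ}
    (hyz : (u e = y ∧ v e = z) ∨ (u e = z ∧ v e = y))
    (hz : ∀ l : ℕ, (unit u v).Near N p z l → k ≤ l)
    (hx : (unit u v).Near N p x k)
    (hxy : x ≠ z ∨ ∀ l : ℕ, (unit u v).Near N p y l → k ≤ l) :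
    (unit u v).Near (N.erase e) p x k := by
  have key : ∀ w : α, (∀ l : ℕ, (unit u v).Near N p w l → k ≤ l) → ∀ a : ℝ,
      (unit u v).Near N p w a → a + 1 ≤ k → False := by
    intro w hw a ha hak
    have h0 := ha.nonneg
    have hk : 1 ≤ k := by exact_mod_cast (by linarith : (1 : ℝ) ≤ k)
    have := hw (k - 1) (ha.mono subset_rfl (by push_cast [hk]; linarith))
    omega
  have main : ∀ a b : ℝ, a + b + 1 ≤ k →
      ((unit u v).Near (N.erase e) p y a ∧ (unit u v).Near (N.erase e) z x b) ∨
      ((unit u v).Near (N.erase e) p z a ∧ (unit u v).Near (N.erase e) y x b) → False := by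
    rintro a b hab (⟨h1, h2⟩ | ⟨h1, h2⟩)
    · have h1' := h1.mono (erase_subset _ _) (le_refl a)
      rcases hxy with hxz | hy
      · have hyz' : (unit u v).Near N y z 1 := by
          rcases hyz with ⟨rfl, rfl⟩ | ⟨rfl, rfl⟩
          · exact (unit_near_symm_ends he).1
          · exact (unit_near_symm_ends he).2
        by_cases hb : b < 1
        · exact hxz (h2.eq_of_lt_one hb).symm
        · exact key z hz (a + 1) (h1'.trans hyz') (by linarith)
      · exact key y hy a h1' (by linarith [h2.nonneg])
    · exact key z hz a (h1.mono (erase_subset _ _) le_rfl) (by linarith [h2.nonneg])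
  rw [← insert_erase he] at hx
  rcases hx.of_insert with h | ⟨a, b, hab, h⟩
  · exact h
  · exfalso
    change a + b + 1 ≤ (k : ℝ) at hab
    refine main a b hab ?_
    change (_ ∧ (unit u v).Near _ (v e) x b) ∨ (_ ∧ (unit u v).Near _ (u e) x b) at h
    change ((unit u v).Near _ p (u e) a ∧ _) ∨ ((unit u v).Near _ p (v e) a ∧ _) at h
    rcases hyz with ⟨rfl, rfl⟩ | ⟨rfl, rfl⟩
    · exact h
    · exact h.symm

lemma unit_card_touching_le {u v : ι → α} {N : Finset ι} {A : Finset α} {p : α} {i : ℕ}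
    (hA : ∀ e ∈ N, u e ∈ A ∧ v e ∈ A)
    (hN : ∀ e ∈ N, ¬ (unit u v).Near (N.erase e) (u e) (v e) (2 * i + 1)) :
    (N.filter fun e => (unit u v).Near N p (u e) i ∨ (unit u v).Near N p (v e) i).card ≤
      (A.filter fun x => (unit u v).Near N p x (i + 1)).card := by
  set h : α → ℕ := fun x => sInf {k : ℕ | (unit u v).Near N p x k} with hh
  have hle : ∀ x (l : ℕ), (unit u v).Near N p x l → h x ≤ l := fun x l hl => Nat.sInf_le hl
  have hmem : ∀ x (l : ℕ), (unit u v).Near N p x l → (unit u v).Near N p x (h x) :=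
    fun x l hl => Nat.sInf_mem (s := {k : ℕ | (unit u v).Near N p x k}) ⟨l, hl⟩
  set far : ι → α := fun e => if h (u e) ≤ h (v e) then v e else u e with hfar
  set ner : ι → α := fun e => if h (u e) ≤ h (v e) then u e else v e with hner
  have hne : ∀ e ∈ N, u e ≠ v e := fun e he heq =>
    hN e he (heq ▸ Near.refl _ (by positivity))
  have hends : ∀ e, (u e = ner e ∧ v e = far e) ∨ (u e = far e ∧ v e = ner e) := by
    intro e
    simp only [hfar, hner]
    split_ifs <;> simp
  have hnf : ∀ e, h (ner e) ≤ h (far e) := by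
    intro e
    simp only [hfar, hner]
    split_ifs <;> omega
  have hadj : ∀ e ∈ N, (unit u v).Near N (ner e) (far e) 1 := by
    intro e he
    rcases hends e with ⟨h1, h2⟩ | ⟨h1, h2⟩
    · rw [← h1, ← h2]; exact (unit_near_symm_ends he).1
    · rw [← h1, ← h2]; exact (unit_near_symm_ends he).2
  have hnear : ∀ e ∈ N, ((unit u v).Near N p (u e) i ∨ (unit u v).Near N p (v e) i) →
      (unit u v).Near N p (ner e) (h (ner e)) ∧ h (ner e) ≤ i := by
    intro e he hcase
    have hu := (unit_near_symm_ends (u := u) (v := v) he)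
    have hex : ∀ x, (x = u e ∨ x = v e) → (unit u v).Near N p x (i + 1 : ℕ) := by
      intro x hx
      push_cast
      rcases hx with rfl | rfl <;> rcases hcase with hc | hc
      · exact hc.mono subset_rfl (by linarith)
      · exact hc.trans hu.2
      · exact hc.trans hu.1
      · exact hc.mono subset_rfl (by linarith)
    have hnm : ner e = u e ∨ ner e = v e := by
      rcases hends e with ⟨h1, h2⟩ | ⟨h1, h2⟩
      · exact .inl h1.symm
      · exact .inr h2.symm
    refine ⟨hmem _ _ (hex _ hnm), ?_⟩
    have h3 : h (ner e) ≤ h (u e) ∧ h (ner e) ≤ h (v e) := by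
      simp only [hner]
      split_ifs <;> constructor <;> omega
    rcases hcase with hc | hc
    · exact h3.1.trans (hle _ _ hc)
    · exact h3.2.trans (hle _ _ hc)
  refine card_le_card_of_injOn far ?_ ?_
  · intro e he
    simp only [coe_filter, Set.mem_ofPred_eq] at he ⊢
    obtain ⟨hn1, hn2⟩ := hnear e he.1 he.2
    constructor
    · rcases hends e with ⟨h1, h2⟩ | ⟨h1, h2⟩
      · rw [← h2]; exact (hA e he.1).2
      · rw [← h1]; exact (hA e he.1).1
    · refine (hn1.trans (hadj e he.1)).mono subset_rfl ?_
      have : (h (ner e) : ℝ) ≤ i := by exact_mod_cast hn2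
      linarith
  · intro e he e' he' hee
    simp only [coe_filter, Set.mem_ofPred_eq] at he he'
    by_contra hcon
    obtain ⟨hn1, hn2⟩ := hnear e he.1 he.2
    obtain ⟨hn1', hn2'⟩ := hnear e' he'.1 he'.2
    have hzne : ner e' ≠ far e := by
      rw [hee]
      intro hx
      rcases hends e' with ⟨h1, h2⟩ | ⟨h1, h2⟩
      · exact hne e' he'.1 (by rw [h1, h2, hx])
      · exact hne e' he'.1 (by rw [h1, h2, hx])
    have w1 : (unit u v).Near (N.erase e) p (ner e) (h (ner e)) :=
      unit_avoid he.1 (hends e) (fun l hl => (hnf e).trans (hle _ _ hl)) hn1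
        (.inr fun l hl => hle _ _ hl)
    have w2 : (unit u v).Near (N.erase e) p (ner e') (h (ner e')) := by
      refine unit_avoid he.1 (hends e) (fun l hl => ?_) hn1' (.inl hzne)
      have := hnf e'
      rw [← hee] at this
      exact this.trans (hle _ _ hl)
    have w3 : (unit u v).Near (N.erase e) (ner e') (far e) 1 := by
      have he'' : e' ∈ N.erase e := mem_erase.2 ⟨Ne.symm hcon, he'.1⟩
      rw [hee]
      rcases hends e' with ⟨h1, h2⟩ | ⟨h1, h2⟩
      · rw [← h1, ← h2]; exact (unit_near_symm_ends he'').1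
      · rw [← h1, ← h2]; exact (unit_near_symm_ends he'').2
    have b1 : (h (ner e) : ℝ) ≤ i := by exact_mod_cast hn2
    have b2 : (h (ner e') : ℝ) ≤ i := by exact_mod_cast hn2'
    have w4 : (unit u v).Near (N.erase e) (ner e) (far e) (2 * i + 1) :=
      (w1.symm.trans (w2.trans w3)).mono subset_rfl (by linarith)
    rcases hends e with ⟨h1, h2⟩ | ⟨h1, h2⟩
    · exact hN e he.1 (by rw [h1, h2]; exact w4)
    · exact hN e he.1 (by rw [h1, h2]; exact w4.symm)

/-- Moore bound: a multigraph of logarithmic girth has at most twice as many edges as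
vertices. -/
lemma unit_card_le {u v : ι → α} {L : ℕ} (A : Finset α) (N : Finset ι)
    (hL : Nat.log 2 A.card ≤ L) (hA : ∀ e ∈ N, u e ∈ A ∧ v e ∈ A)
    (hN : ∀ e ∈ N, ¬ (unit u v).Near (N.erase e) (u e) (v e) (2 * L + 1)) :
    N.card ≤ 2 * A.card := by
  induction A using Finset.strongInduction generalizing N with
  | H A ih =>
  rcases A.eq_empty_or_nonempty with rfl | ⟨p, hp⟩
  · have : N = ∅ := eq_empty_of_forall_notMem fun e he => by simpa using (hA e he).1
    simp [this]
  set Bl : ℕ → Finset α := fun i => A.filter fun x => (unit u v).Near N p x i with hBl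
  obtain ⟨i, hi, hgrow⟩ : ∃ i ≤ Nat.log 2 A.card, (Bl (i + 1)).card ≤ 2 * (Bl i).card := by
    by_contra hcon
    push Not at hcon
    have : ∀ i ≤ Nat.log 2 A.card + 1, 2 ^ i ≤ (Bl i).card := by
      intro i
      induction i with
      | zero =>
        intro _
        have : p ∈ Bl 0 := mem_filter.2 ⟨hp, Near.refl _ (by simp)⟩
        simpa using card_pos.2 ⟨p, this⟩
      | succ i ihi =>
        intro hi
        have h1 := ihi (by omega)
        have h2 := hcon i (by omega)
        rw [pow_succ]
        omega
    have h1 := this _ le_rfl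
    have h2 : (Bl (Nat.log 2 A.card + 1)).card ≤ A.card := card_le_card (filter_subset _ _)
    have h3 := Nat.lt_pow_succ_log_self (b := 2) (by norm_num) A.card
    omega
  have hiL : (i : ℝ) ≤ L := by exact_mod_cast hi.trans hL
  have hcard := unit_card_touching_le (p := p) (i := i) hA
    (fun e he hc => hN e he (hc.mono subset_rfl (by linarith)))
  have hB1 : (A.filter fun x => (unit u v).Near N p x (i + 1)) = Bl (i + 1) := by
    simp [hBl]
  rw [hB1] at hcard
  have hpB : p ∈ Bl i := mem_filter.2 ⟨hp, Near.refl _ (by positivity)⟩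
  set N1 := N.filter fun e => (unit u v).Near N p (u e) i ∨ (unit u v).Near N p (v e) i
  have hsub : A \ Bl i ⊂ A :=
    ⟨sdiff_subset, fun h => (mem_sdiff.1 (h hp)).2 hpB⟩
  have hrec := ih (A \ Bl i) hsub (N \ N1)
    ((Nat.log_mono_right (card_le_card sdiff_subset)).trans hL) ?_ ?_
  · have h1 : (N \ N1).card + N1.card = N.card := card_sdiff_add_card_eq_card (filter_subset _ _)
    have h2 : (A \ Bl i).card + (Bl i).card = A.card :=
      card_sdiff_add_card_eq_card (filter_subset _ _)
    omega
  · intro e he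
    rw [mem_sdiff] at he
    have h1 := hA e he.1
    have h2 : ¬ ((unit u v).Near N p (u e) i ∨ (unit u v).Near N p (v e) i) :=
      fun h => he.2 (mem_filter.2 ⟨he.1, h⟩)
    push Not at h2
    exact ⟨mem_sdiff.2 ⟨h1.1, fun h => h2.1 (mem_filter.1 h).2⟩,
      mem_sdiff.2 ⟨h1.2, fun h => h2.2 (mem_filter.1 h).2⟩⟩
  · intro e he hc
    exact hN e (mem_sdiff.1 he).1
      (hc.mono (erase_subset_erase _ sdiff_subset) le_rfl)

end LinkSystem

/-- Total value of `m` on the class of `q` with label `a`. -/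
noncomputable def classMass {α : Type*} [Fintype α] (q : α → α) (m : α → ℝ) (a : α) : ℝ :=
  ∑ x with q x = a, m x

lemma sum_classMass {α : Type*} [Fintype α] (q : α → α) (m : α → ℝ) (B : Finset α) :
    ∑ b ∈ B, classMass q m b = ∑ x with q x ∈ B, m x := by
  rw [← sum_fiberwise_of_maps_to (s := univ.filter fun x => q x ∈ B) (t := B) (g := q)
    (fun x hx => (mem_filter.1 hx).2)]
  refine sum_congr rfl fun b hb => ?_
  unfold classMass
  refine sum_congr ?_ fun _ _ => rfl
  ext x
  simp only [mem_filter, mem_univ, true_and]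
  constructor
  · rintro rfl; exact ⟨hb, rfl⟩
  · exact fun h => h.2

lemma sum_classMass_le {α : Type*} [Fintype α] {q q' : α → α} {m : α → ℝ} (hm : ∀ x, 0 ≤ m x)
    {B : Finset α} {c : α} (hB : ∀ x, q x ∈ B → q' x = c) :
    ∑ b ∈ B, classMass q m b ≤ classMass q' m c := by
  rw [sum_classMass]
  refine sum_le_sum_of_subset_of_nonneg ?_ fun x _ _ => hm x
  intro x hx
  exact mem_filter.2 ⟨mem_univ _, hB x (mem_filter.1 hx).2⟩

lemma classMass_le {α : Type*} [Fintype α] {q q' : α → α} {m : α → ℝ} (hm : ∀ x, 0 ≤ m x)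
    {b c : α} (hB : ∀ x, q x = b → q' x = c) : classMass q m b ≤ classMass q' m c := by
  simpa using sum_classMass_le (q := q) (q' := q') hm (B := {b}) (c := c)
    (fun x hx => hB x (by simpa using hx))

lemma classMass_add_le {α : Type*} [Fintype α] {q q' : α → α} {m : α → ℝ} (hm : ∀ x, 0 ≤ m x)
    {a b c : α} (hab : a ≠ b) (ha : ∀ x, q x = a → q' x = c) (hb : ∀ x, q x = b → q' x = c) :
    classMass q m a + classMass q m b ≤ classMass q' m c := by
  have := sum_classMass_le (q := q) (q' := q') hm (B := {a, b}) (c := c) ?_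
  · rwa [sum_pair hab] at this
  · intro x hx
    rcases mem_insert.1 hx with h | h
    · exact ha x h
    · exact hb x (by simpa using h)

lemma classMass_add_add_le {α : Type*} [Fintype α] {q q' : α → α} {m : α → ℝ}
    (hm : ∀ x, 0 ≤ m x) {a b d c : α} (hab : a ≠ b) (had : a ≠ d) (hbd : b ≠ d)
    (ha : ∀ x, q x = a → q' x = c) (hb : ∀ x, q x = b → q' x = c)
    (hd : ∀ x, q x = d → q' x = c) :
    classMass q m a + classMass q m b + classMass q m d ≤ classMass q' m c := by
  have := sum_classMass_le (q := q) (q' := q') hm (B := {a, b, d}) (c := c) ?_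
  · rwa [sum_insert (by simp [hab, had]), sum_pair hbd, ← add_assoc] at this
  · intro x hx
    simp only [mem_insert, mem_singleton] at hx
    rcases hx with h | h | h
    · exact ha x h
    · exact hb x h
    · exact hd x h

namespace LinkSystem

variable {α ι : Type*} [Fintype α]

/-- Repeatedly merge adjacent light classes. -/
lemma exists_merge (P : LinkSystem α ι) (F : Finset ι) {X Y : ℝ} {m : α → ℝ}
    (hm : ∀ x, 0 ≤ m x) (q : α → α)
    (hq : ∀ x y, q x = q y → P.Near F x y (classMass q m (q x) - 1))
    (hb : ∀ a, classMass q m a < 2 * X ∨ ∀ x y, q x = a → q y = a → P.Near F x y Y) :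
    ∃ q' : α → α, (∀ x y, q x = q y → q' x = q' y) ∧
      (∀ x y, q' x = q' y → P.Near F x y (classMass q' m (q' x) - 1)) ∧
      (∀ a, classMass q' m a < 2 * X ∨ ∀ x y, q' x = a → q' y = a → P.Near F x y Y) ∧
      ∀ x y, P.base x y → q' x ≠ q' y →
        X ≤ classMass q' m (q' x) ∨ X ≤ classMass q' m (q' y) := by
  induction hn : (univ.image q).card using Nat.strong_induction_on generalizing q with
  | _ n ih =>
  subst hn
  by_cases hdone : ∀ x y, P.base x y → q x ≠ q y →
        X ≤ classMass q m (q x) ∨ X ≤ classMass q m (q y)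
  · exact ⟨q, fun _ _ h => h, hq, hb, hdone⟩
  push Not at hdone
  obtain ⟨x, y, hxy, hne, hx, hy⟩ := hdone
  set q' : α → α := fun z => if q z = q y then q x else q z with hq'
  have hcard : (univ.image q').card < (univ.image q).card := by
    refine card_lt_card ((ssubset_iff_of_subset ?_).2 ⟨q y, by simp, ?_⟩)
    · intro a ha
      obtain ⟨z, -, rfl⟩ := mem_image.1 ha
      simp only [hq']
      split_ifs <;> simp
    · intro ha
      obtain ⟨z, -, hz⟩ := mem_image.1 ha
      simp only [hq'] at hz
      split_ifs at hz with h
      · exact hne hz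
      · exact h hz
  have hcoarse : ∀ z w, q z = q w → q' z = q' w := fun z w h => by simp [hq', h]
  have h1 : ∀ z, q z = q x → q' z = q x := fun z h => by simp [hq', h, hne]
  have h2 : ∀ z, q z = q y → q' z = q x := fun z h => by simp [hq', h]
  have hcases : ∀ z, q' z = q x → q z = q x ∨ q z = q y := by
    intro z h
    simp only [hq'] at h
    split_ifs at h with h'
    · exact .inr h'
    · exact .inl h
  have hother : ∀ z c, q' z = c → c ≠ q x → q z = c := by
    intro z c h hc
    simp only [hq'] at h
    split_ifs at h with h'
    · exact absurd h.symm hc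
    · exact h
  have hcross : ∀ z w, q z = q x → q w = q y → P.Near F z w (classMass q' m (q x) - 1) := by
    intro z w hz hw
    have a1 := hq z x hz
    have a2 := hq y w hw.symm
    rw [hz] at a1
    have := classMass_add_le (q := q) (q' := q') hm hne h1 h2
    exact (a1.trans ((near_base hxy).trans a2)).mono subset_rfl (by linarith)
  have hrec := ih _ hcard q' ?_ ?_ rfl
  · obtain ⟨q2, c1, c2⟩ := hrec
    exact ⟨q2, fun z w h => c1 z w (hcoarse z w h), c2⟩
  · intro z w hzw
    by_cases hold : q z = q w
    · exact (hq z w hold).mono subset_rfl (by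
        linarith [classMass_le (q := q) (q' := q') hm (b := q z) (c := q' z)
          (fun v hv => hcoarse v z hv)])
    · have hzx : q' z = q x := by
        by_contra hc
        exact hold ((hother z _ rfl hc).trans (hother w _ hzw.symm hc).symm)
      have hwx : q' w = q x := hzw ▸ hzx
      rw [hzx]
      rcases hcases z hzx with hz | hz <;> rcases hcases w hwx with hw | hw
      · exact absurd (hz.trans hw.symm) hold
      · exact hcross z w hz hw
      · exact (hcross w z hw hz).symm
      · exact absurd (hz.trans hw.symm) hold
  · intro a
    by_cases ha : a = q x
    · left
      subst ha
      have : classMass q' m (q x) ≤ classMass q m (q x) + classMass q m (q y) := by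
        unfold classMass
        rw [← sum_union (by
          rw [disjoint_left]
          intro z hz hz'
          exact hne ((mem_filter.1 hz).2.symm.trans (mem_filter.1 hz').2))]
        refine sum_le_sum_of_subset_of_nonneg ?_ fun x _ _ => hm x
        intro z hz
        rcases hcases z (mem_filter.1 hz).2 with h | h
        · exact mem_union_left _ (mem_filter.2 ⟨mem_univ _, h⟩)
        · exact mem_union_right _ (mem_filter.2 ⟨mem_univ _, h⟩)
      linarith
    · rcases hb a with h | h
      · left
        exact (classMass_le hm fun v hv => hother v a hv ha).trans_lt h
      · right
        exact fun z w hz hw => h z w (hother z a hz ha) (hother w a hw ha)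

/-- Coarsen a partition so that all classes become heavy (or there is a single class). -/
lemma exists_grouping (P : LinkSystem α ι) (F : Finset ι) {X Y : ℝ} (hX : 0 ≤ X) (hY : 0 ≤ Y) {m : α → ℝ}
    (hm : ∀ x, 0 ≤ m x) (hconn : ∀ x y, ∃ r, P.Near ∅ x y r) (q : α → α)
    (hq : ∀ x y, q x = q y → P.Near F x y (classMass q m (q x) - 1))
    (hb : ∀ a, classMass q m a < 2 * X ∨ ∀ x y, q x = a → q y = a → P.Near F x y Y) :
    ∃ q' : α → α, (∀ x y, q x = q y → q' x = q' y) ∧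
      (∀ x y, q' x = q' y → P.Near F x y (classMass q' m (q' x) - 1)) ∧
      (∀ x y, q' x = q' y → P.Near F x y (4 * X + Y)) ∧
      ((∀ x, X ≤ classMass q' m (q' x)) ∨ ∀ x y, q' x = q' y) := by
  obtain ⟨q1, hco, hq1, hb1, hadj⟩ := exists_merge P F hm q hq hb
  have hdiam : ∀ x y, q1 x = q1 y → P.Near F x y (2 * X + Y) := by
    intro x y h
    rcases hb1 (q1 x) with h1 | h1
    · exact (hq1 x y h).mono subset_rfl (by linarith)
    · exact (h1 x y rfl h.symm).mono subset_rfl (by linarith)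
  by_cases hone : ∀ x y, q1 x = q1 y
  · exact ⟨q1, hco, hq1, fun x y h => (hdiam x y h).mono subset_rfl (by linarith), .inr hone⟩
  have hnbr : ∀ a, classMass q1 m a < X → (∃ x, q1 x = a) →
      ∃ l r, q1 l = a ∧ q1 r ≠ a ∧ P.base l r := by
    rintro a - ⟨x, hx⟩
    obtain ⟨y, hy⟩ : ∃ y, q1 y ≠ a := by
      by_contra hcon
      push Not at hcon
      exact hone fun x y => (hcon x).trans (hcon y).symm
    obtain ⟨r, hr⟩ := hconn x y
    obtain ⟨l, r, h1, h2, h3⟩ := hr.exists_boundary (S := {z | q1 z = a}) hx hy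
    exact ⟨l, r, h1, h2, h3⟩
  choose! lp rp hl hr hlr using hnbr
  set q2 : α → α := fun x => if classMass q1 m (q1 x) < X then q1 (rp (q1 x)) else q1 x with hq2
  have hsmall : ∀ x, classMass q1 m (q1 x) < X →
      q1 (lp (q1 x)) = q1 x ∧ q1 (rp (q1 x)) ≠ q1 x ∧ P.base (lp (q1 x)) (rp (q1 x)) ∧
      X ≤ classMass q1 m (q1 (rp (q1 x))) ∧ q2 x = q1 (rp (q1 x)) := by
    intro x hx
    have e1 := hl (q1 x) hx ⟨x, rfl⟩
    have e2 := hr (q1 x) hx ⟨x, rfl⟩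
    have e3 := hlr (q1 x) hx ⟨x, rfl⟩
    refine ⟨e1, e2, e3, ?_, by simp [hq2, hx]⟩
    rcases hadj _ _ e3 (by rw [e1]; exact e2.symm) with h | h
    · rw [e1] at h; linarith
    · exact h
  have hbig : ∀ x, ¬ classMass q1 m (q1 x) < X → q2 x = q1 x := fun x hx => by simp [hq2, hx]
  have hco2 : ∀ x y, q1 x = q1 y → q2 x = q2 y := fun x y h => by simp [hq2, h]
  have hq2big : ∀ x, X ≤ classMass q1 m (q2 x) := by
    intro x
    by_cases hx : classMass q1 m (q1 x) < X
    · rw [(hsmall x hx).2.2.2.2]; exact (hsmall x hx).2.2.2.1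
    · rw [hbig x hx]; exact not_lt.1 hx
  have hcen : ∀ x z, q1 z = q2 x → q2 z = q2 x := by
    intro x z hz
    rw [← hz]
    exact hbig z (by rw [hz]; exact not_lt.2 (hq2big x))
  have hmain : ∀ x y, q2 x = q2 y → q1 x ≠ q1 y →
      P.Near F x y (classMass q2 m (q2 x) - 1) ∧ P.Near F x y (4 * X + Y) := by
    have half : ∀ x y, q2 x = q2 y → q1 x ≠ q1 y → classMass q1 m (q1 x) < X →
      P.Near F x y (classMass q2 m (q2 x) - 1) ∧ P.Near F x y (4 * X + Y) := by
      intro x y hxy hne hx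
      obtain ⟨e1, e2, e3, e4, e5⟩ := hsmall x hx
      have n1 := (hq1 x (lp (q1 x)) e1.symm).trans (near_base (F := F) e3)
      by_cases hy : classMass q1 m (q1 y) < X
      · obtain ⟨f1, f2, f3, f4, f5⟩ := hsmall y hy
        have n2 := (hq1 y (lp (q1 y)) f1.symm).trans (near_base (F := F) f3)
        have hrr : q1 (rp (q1 x)) = q1 (rp (q1 y)) := by rw [← e5, ← f5, hxy]
        have hmass := classMass_add_add_le (q := q1) (q' := q2) hm (a := q1 x) (b := q1 y)
          (d := q1 (rp (q1 x))) (c := q2 x) hne e2.symm (by rw [hrr]; exact f2.symm)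
          (fun v hv => hco2 v x hv) (fun v hv => (hco2 v y hv).trans hxy.symm)
          (fun v hv => hcen x v (by rw [hv, e5]))
        exact ⟨((n1.trans (hq1 _ _ hrr)).trans n2.symm).mono subset_rfl (by linarith),
          ((n1.trans (hdiam _ _ hrr)).trans n2.symm).mono subset_rfl (by linarith)⟩
      · have hrr : q1 (rp (q1 x)) = q1 y := by rw [← e5, hxy, hbig y hy]
        have hmass := classMass_add_le (q := q1) (q' := q2) hm (a := q1 x)
          (b := q1 (rp (q1 x))) (c := q2 x) e2.symm
          (fun v hv => hco2 v x hv) (fun v hv => hcen x v (by rw [hv, e5]))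
        exact ⟨(n1.trans (hq1 _ _ hrr)).mono subset_rfl (by linarith),
          (n1.trans (hdiam _ _ hrr)).mono subset_rfl (by linarith)⟩
    intro x y hxy hne
    by_cases hx : classMass q1 m (q1 x) < X
    · exact half x y hxy hne hx
    by_cases hy : classMass q1 m (q1 y) < X
    · obtain ⟨h1, h2⟩ := half y x hxy.symm hne.symm hy
      exact ⟨hxy ▸ h1.symm, h2.symm⟩
    · exact absurd (by rw [← hbig x hx, ← hbig y hy, hxy]) hne
  refine ⟨q2, fun x y h => hco2 x y (hco x y h), ?_, ?_, .inl ?_⟩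
  · intro x y h
    by_cases hxy : q1 x = q1 y
    · exact (hq1 x y hxy).mono subset_rfl (by
        linarith [classMass_le (q := q1) (q' := q2) hm (b := q1 x) (c := q2 x)
          (fun v hv => hco2 v x hv)])
    · exact (hmain x y h hxy).1
  · intro x y h
    by_cases hxy : q1 x = q1 y
    · exact (hdiam x y hxy).mono subset_rfl (by linarith)
    · exact (hmain x y h hxy).2
  · intro x
    exact (hq2big x).trans (classMass_le hm fun v hv => hcen x v hv)

end LinkSystem

/-- In a finite graph whose edges all meet a set of hubs, the non-isolated vertices can be
grouped around some hubs, each group containing all neighbours of its hub and having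
radius at most three. -/
lemma exists_star_cover {α : Type*} [Fintype α] {Γ : α → α → Prop} {Hv : α → Prop}
    (hsymm : ∀ a b, Γ a b → Γ b a) (hhub : ∀ a b, Γ a b → Hv a ∨ Hv b) :
    ∃ g : α → α, ∀ a, (∃ b, Γ a b) →
      Hv (g a) ∧ (∃ b, Γ (g a) b) ∧ g (g a) = g a ∧ (∀ b, Γ (g a) b → g b = g a) ∧
      ∃ b c, (a = b ∨ Γ a b) ∧ (b = c ∨ Γ b c) ∧ (c = g a ∨ Γ c (g a)) := by
  set Q : α → α → Prop := fun i b => i = b ∨ Γ i b with hQ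
  set good : Finset α → Prop := fun I => (∀ i ∈ I, Hv i ∧ ∃ b, Γ i b) ∧
    ∀ i ∈ I, ∀ j ∈ I, ∀ b, Q i b → Q j b → i = j with hgood
  obtain ⟨I, hI, hmax⟩ := (univ.filter good).exists_max_image card
    ⟨∅, mem_filter.2 ⟨mem_univ _, by simp [hgood]⟩⟩
  obtain ⟨hI1, hI2⟩ := (mem_filter.1 hI).2
  have hmeet : ∀ h, Hv h → (∃ b, Γ h b) → ∃ i ∈ I, ∃ b, Q i b ∧ Q h b := by
    intro h hh hne
    by_contra hcon
    push Not at hcon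
    have hnot : h ∉ I := fun hmem => hcon h hmem h (.inl rfl) (.inl rfl)
    have := hmax (insert h I) (mem_filter.2 ⟨mem_univ _, ?_, ?_⟩)
    · rw [card_insert_of_notMem hnot] at this
      omega
    · intro i hi
      rcases mem_insert.1 hi with rfl | hi
      · exact ⟨hh, hne⟩
      · exact hI1 i hi
    · intro i hi j hj b hib hjb
      rcases mem_insert.1 hi with hi' | hi' <;> rcases mem_insert.1 hj with hj' | hj'
      · exact hi'.trans hj'.symm
      · exact absurd (hi' ▸ hib) (hcon j hj' b hjb)
      · exact absurd (hj' ▸ hjb) (hcon i hi' b hib)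
      · exact hI2 i hi' j hj' b hib hjb
  have hex : ∀ a, (∃ b, Γ a b) → ∃ i ∈ I,
      ((∃ j ∈ I, Q j a) → Q i a) ∧ ∃ b c, Q a b ∧ Q b c ∧ Q c i := by
    intro a ⟨a', ha⟩
    by_cases hcl : ∃ j ∈ I, Q j a
    · obtain ⟨j, hj, hja⟩ := hcl
      refine ⟨j, hj, fun _ => hja, a, a, .inl rfl, .inl rfl, ?_⟩
      exact hja.imp Eq.symm (hsymm _ _)
    · have hub : ∃ h, Q a h ∧ Hv h ∧ ∃ b, Γ h b := by
        rcases hhub a a' ha with h | h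
        · exact ⟨a, .inl rfl, h, a', ha⟩
        · exact ⟨a', .inr ha, h, a, hsymm _ _ ha⟩
      obtain ⟨h, hah, hh, hne⟩ := hub
      obtain ⟨i, hi, b, hib, hhb⟩ := hmeet h hh hne
      exact ⟨i, hi, fun hc => absurd hc hcl, h, b, hah, hhb, hib.imp Eq.symm (hsymm _ _)⟩
  choose! g hg1 hg2 hg3 using hex
  refine ⟨g, fun a ha => ?_⟩
  have hgI := hg1 a ha
  have hself : ∀ b, (∃ c, Γ b c) → Q (g a) b → g b = g a := fun b hb hq =>
    hI2 _ (hg1 b hb) _ hgI b (hg2 b hb ⟨_, hgI, hq⟩) hq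
  exact ⟨(hI1 _ hgI).1, (hI1 _ hgI).2, hself _ (hI1 _ hgI).2 (.inl rfl),
    fun b hb => hself b ⟨_, hsymm _ _ hb⟩ (.inr hb), hg3 a ha⟩

namespace LinkSystem

variable {α ι : Type*}

/-- Walks between contracted classes lift to walks between the points of the classes. -/
lemma Near.lift {P : LinkSystem α ι} {R F : Finset ι} {q : α → α} {W Z k : ℝ} {a b : α} (hZ0 : 0 ≤ Z)
    (hW : ∀ x y, q x = q y → P.Near R x y W) (hZ : ∀ e ∈ F, P.len e ≤ Z)
    (h : (unit (fun e => q (P.src e)) fun e => q (P.dst e)).Near F a b k) {x y : α}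
    (hx : q x = a) (hy : q y = b) : P.Near (R ∪ F) x y ((k + 1) * W + k * Z) := by
  have hW0 : 0 ≤ W := (hW x x rfl).nonneg
  have step : ∀ {e : ι} (_ : e ∈ F) {x y z w : α} {r s : ℝ}, P.Near (R ∪ F) x y r →
      ((y = P.src e ∧ z = P.dst e) ∨ (y = P.dst e ∧ z = P.src e)) → q w = q z →
      r + Z + W ≤ s → P.Near (R ∪ F) x w s := by
    intro e he x y z w r s h1 h2 h3 h4
    have h5 : P.Near (R ∪ F) y z (P.len e) := by
      rcases h2 with ⟨rfl, rfl⟩ | ⟨rfl, rfl⟩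
      · exact near_fwd (mem_union_right _ he)
      · exact near_bwd (mem_union_right _ he)
    exact ((h1.trans h5).trans ((hW z w h3.symm).mono subset_union_left le_rfl)).mono
      subset_rfl (by linarith [hZ e he])
  induction h generalizing y with
  | refl r hr =>
    refine (hW x y (hx.trans hy.symm)).mono subset_union_left ?_
    have h1 : 0 ≤ r * W := by positivity
    have h2 : 0 ≤ r * Z := by positivity
    nlinarith
  | base y z s s' _ hb hs ih => exact hb.elim
  | fwd e s s' _ he hs ih =>
    refine step he (ih (y := P.src e) rfl) (.inl ⟨rfl, rfl⟩) hy ?_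
    change s + 1 ≤ s' at hs
    nlinarith [hZ e he, P.one_le_len e]
  | bwd e s s' _ he hs ih =>
    refine step he (ih (y := P.dst e) rfl) (.inr ⟨rfl, rfl⟩) hy ?_
    change s + 1 ≤ s' at hs
    nlinarith [hZ e he, P.one_le_len e]

variable [Fintype α]

/-- A set of links none of which can be replaced by a walk `τ` times as long, with the
lengths sorted into scales. -/
structure Sparse (P : LinkSystem α ι) (E : Finset ι) (lev : ι → ℕ) (S : ℕ) (τ : ℝ) : Prop where
  le_len : ∀ e, (20 : ℝ) ^ lev e ≤ P.len e
  len_lt : ∀ e, P.len e < (20 : ℝ) ^ (lev e + 1)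
  irred : ∀ e ∈ E, ¬ P.Near (E.erase e) (P.src e) (P.dst e) (τ * P.len e)
  le_tau : 40 * (20 : ℝ) ^ S + 20 ≤ τ
  log_le_tau : 40 * (2 * (Nat.log 2 (Fintype.card α) : ℝ) + 2) ≤ τ

variable {P : LinkSystem α ι} {E R : Finset ι} {lev : ι → ℕ} {S J : ℕ} {τ : ℝ} {q : α → α}

lemma Sparse.not_inner (hs : P.Sparse E lev S τ) (hR : R ⊆ E)
    (hq : ∀ x y, q x = q y → P.Near R x y (20 * 20 ^ J)) {e : ι} (he : e ∈ E \ R)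
    (hJ : J ≤ lev e + S) : q (P.src e) ≠ q (P.dst e) := by
  intro h
  rw [mem_sdiff] at he
  refine hs.irred e he.1 ((hq _ _ h).mono ?_ ?_)
  · exact fun f hf => mem_erase.2 ⟨fun h => he.2 (h ▸ hf), hR hf⟩
  · have h1 : (20 : ℝ) ^ J ≤ 20 ^ S * 20 ^ lev e := by
      rw [← pow_add]; exact pow_le_pow_right₀ (by norm_num) (by omega)
    have h2 := hs.le_len e
    have h3 := hs.le_tau
    have h4 : (0 : ℝ) < 20 ^ S := by positivity
    have h5 := P.one_le_len e
    nlinarith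

lemma Sparse.not_short (hs : P.Sparse E lev S τ) (hR : R ⊆ E) {W k : ℝ}
    (hq : ∀ x y, q x = q y → P.Near R x y W) {e : ι} (he : e ∈ E \ R) {F : Finset ι}
    (hF : F ⊆ E) (heF : e ∉ F) (hZ : ∀ f ∈ F, lev f = lev e)
    (hbd : (k + 1) * W + k * 20 ^ (lev e + 1) ≤ τ * 20 ^ lev e) :
    ¬ (unit (fun e => q (P.src e)) fun e => q (P.dst e)).Near F
      (q (P.src e)) (q (P.dst e)) k := by
  intro h
  rw [mem_sdiff] at he
  have hl := h.lift (P := P) (Z := 20 ^ (lev e + 1)) (by positivity) hq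
    (fun f hf => by rw [← hZ f hf]; exact (hs.len_lt f).le) rfl rfl
  refine hs.irred e he.1 (hl.mono ?_ ?_)
  · intro f hf
    rcases mem_union.1 hf with hf | hf
    · exact mem_erase.2 ⟨fun h => he.2 (h ▸ hf), hR hf⟩
    · exact mem_erase.2 ⟨fun h => heF (h ▸ hf), hF hf⟩
  · have h0 : 0 ≤ τ := by
      have := hs.le_tau
      have : (0 : ℝ) < 20 ^ S := by positivity
      linarith
    exact hbd.trans (mul_le_mul_of_nonneg_left (hs.le_len e) h0)

lemma Sparse.not_parallel (hs : P.Sparse E lev S τ) (hR : R ⊆ E)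
    (hq : ∀ x y, q x = q y → P.Near R x y (20 * 20 ^ J)) {e f : ι} (he : e ∈ E \ R)
    (hf : f ∈ E \ R) (hef : e ≠ f) (hlev : lev f = lev e) (hJ : J ≤ lev e + S) {a b : α}
    (h1 : (q (P.src e) = a ∧ q (P.dst e) = b) ∨ (q (P.src e) = b ∧ q (P.dst e) = a))
    (h2 : (q (P.src f) = a ∧ q (P.dst f) = b) ∨ (q (P.src f) = b ∧ q (P.dst f) = a)) :
    False := by
  refine hs.not_short hR hq he (F := {f}) (k := 1)
    (by simpa using (mem_sdiff.1 hf).1) (by simpa using hef) (by simpa using hlev)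
    ?_ ?_
  · have h1 : (20 : ℝ) ^ J ≤ 20 ^ S * 20 ^ lev e := by
      rw [← pow_add]; exact pow_le_pow_right₀ (by norm_num) (by omega)
    have h3 := mul_le_mul_of_nonneg_right hs.le_tau (by positivity : (0 : ℝ) ≤ 20 ^ lev e)
    rw [pow_succ]
    nlinarith
  · have h3 := unit_near_symm_ends (u := fun e => q (P.src e)) (v := fun e => q (P.dst e))
      (mem_singleton_self f)
    rcases h1 with ⟨h1, h1'⟩ | ⟨h1, h1'⟩ <;> rcases h2 with ⟨h2, h2'⟩ | ⟨h2, h2'⟩ <;>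
      simp only [h1, h1', h2, h2'] at h3 ⊢
    exacts [h3.1, h3.2, h3.2, h3.1]


/-- Contract the links at classes incident to many links of one scale. -/
lemma Sparse.exists_contraction (hs : P.Sparse E lev S τ) (hR : R ⊆ E) {m : α → ℝ}
    (hm : ∀ x, 0 ≤ m x)
    (hq : ∀ x y, q x = q y → P.Near R x y (20 * 20 ^ J))
    (hqm : ∀ x y, q x = q y → P.Near R x y (classMass q m (q x) - 1))
    (hlarge : (∀ x, 20 ^ J ≤ classMass q m (q x)) ∨ ∀ x y, q x = q y) :
    ∃ (A : Finset α) (q1 : α → α) (m1 : α → ℝ) (R1 : Finset ι),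
      R ⊆ R1 ∧ R1 ⊆ E ∧ (∀ x y, q x = q y → q1 x = q1 y) ∧
      (∀ x y, q1 x = q1 y → P.Near R1 x y (260 * 20 ^ J)) ∧
      (∀ x y, q1 x = q1 y → P.Near R1 x y (classMass q1 m1 (q1 x) - 1)) ∧
      (∀ x, 0 ≤ m1 x) ∧ (∀ x, m1 x ≤ m x) ∧ (∀ x, q x ∈ A → 2 * m1 x ≤ m x) ∧
      (∀ a ∈ A, 20 ^ J ≤ classMass q m a) ∧
      (∀ e ∈ R1 \ R, q (P.src e) ∈ A ∧ q (P.dst e) ∈ A ∧ lev e ≤ J ∧ J ≤ lev e + S) ∧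
      (∀ j ≤ J, J ≤ j + S → ∀ a, ((E \ R1).filter fun e => lev e = j ∧
        (q (P.src e) = a ∨ q (P.dst e) = a)).card ≤ 600) ∧
      ((R1 \ R).filter fun e => lev e = J).card ≤ 2 * A.card := by
  set heavy : ℕ → α → Prop := fun j a => j ≤ J ∧ J ≤ j + S ∧
    600 ≤ ((E \ R).filter fun e => lev e = j ∧ (q (P.src e) = a ∨ q (P.dst e) = a)).card
    with hheavy
  set N : Finset ι := (E \ R).filter fun e =>
    ∃ a, (q (P.src e) = a ∨ q (P.dst e) = a) ∧ heavy (lev e) a with hN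
  set Γ : α → α → Prop := fun a b => ∃ e ∈ N,
    (q (P.src e) = a ∧ q (P.dst e) = b) ∨ (q (P.src e) = b ∧ q (P.dst e) = a) with hΓ
  have hNE : ∀ e ∈ N, e ∈ E \ R ∧ lev e ≤ J ∧ J ≤ lev e + S := by
    intro e he
    obtain ⟨h1, a, -, h2, h3, -⟩ := mem_filter.1 he
    exact ⟨h1, h2, h3⟩
  have hNne : ∀ e ∈ N, q (P.src e) ≠ q (P.dst e) := fun e he =>
    hs.not_inner hR hq (hNE e he).1 (hNE e he).2.2
  have hsymm : ∀ a b, Γ a b → Γ b a := fun a b ⟨e, he, h⟩ => ⟨e, he, h.symm⟩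
  have hhub : ∀ a b, Γ a b → (∃ j, heavy j a) ∨ ∃ j, heavy j b := by
    rintro a b ⟨e, he, h⟩
    obtain ⟨-, c, hc, hc'⟩ := mem_filter.1 he
    rcases h with ⟨rfl, rfl⟩ | ⟨rfl, rfl⟩ <;> rcases hc with rfl | rfl
    exacts [.inl ⟨_, hc'⟩, .inr ⟨_, hc'⟩, .inr ⟨_, hc'⟩, .inl ⟨_, hc'⟩]
  obtain ⟨g, hg⟩ := exists_star_cover (Hv := fun a => ∃ j, heavy j a) hsymm hhub
  set A : Finset α := univ.filter fun a => ∃ b, Γ a b with hA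
  have hmemA : ∀ a, a ∈ A ↔ ∃ b, Γ a b := fun a => by simp [hA]
  have hNA : ∀ e ∈ N, q (P.src e) ∈ A ∧ q (P.dst e) ∈ A := fun e he =>
    ⟨(hmemA _).2 ⟨_, e, he, .inl ⟨rfl, rfl⟩⟩, (hmemA _).2 ⟨_, e, he, .inr ⟨rfl, rfl⟩⟩⟩
  have hAmass : ∀ a ∈ A, (20 : ℝ) ^ J ≤ classMass q m a := by
    intro a ha
    obtain ⟨b, e, he, h⟩ := (hmemA a).1 ha
    rcases hlarge with hl | hl
    · rcases h with ⟨h, -⟩ | ⟨-, h⟩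
      · exact h ▸ hl _
      · exact h ▸ hl _
    · exact absurd (hl _ _) (hNne e he)
  set q1 : α → α := fun x => if q x ∈ A then g (q x) else q x with hq1
  have hgA : ∀ a ∈ A, g a ∈ A := fun a ha => (hmemA _).2 (hg a ((hmemA a).1 ha)).2.1
  have hq1A : ∀ x, q x ∈ A → q1 x = g (q x) := fun x hx => by simp [hq1, hx]
  have hq1n : ∀ x, q x ∉ A → q1 x = q x := fun x hx => by simp [hq1, hx]
  have hcoarse : ∀ x y, q x = q y → q1 x = q1 y := fun x y h => by simp [hq1, h]
  have hD : (1 : ℝ) ≤ 20 ^ J := one_le_pow₀ (by norm_num)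
  have hstar : ∀ a ∈ A, 600 * 20 ^ J ≤ classMass q1 m (g a) := by
    intro a ha
    obtain ⟨⟨j, hj, hjS, hcard⟩, -, -, hnb, -⟩ := hg a ((hmemA a).1 ha)
    set i := g a
    set N1 := (E \ R).filter fun e => lev e = j ∧ (q (P.src e) = i ∨ q (P.dst e) = i) with hN1
    set oth : ι → α := fun e => if q (P.src e) = i then q (P.dst e) else q (P.src e) with hoth
    have hends : ∀ e ∈ N1, (q (P.src e) = i ∧ q (P.dst e) = oth e) ∨
        (q (P.src e) = oth e ∧ q (P.dst e) = i) := by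
      intro e he
      obtain ⟨-, -, h⟩ := mem_filter.1 he
      by_cases hc : q (P.src e) = i
      · exact .inl ⟨hc, by simp [hoth, hc]⟩
      · exact .inr ⟨by simp [hoth, hc], h.resolve_left hc⟩
    have hinj : Set.InjOn oth N1 := by
      intro e he f hf hef
      by_contra hne
      have he' := mem_filter.1 (mem_coe.1 he)
      have hf' := mem_filter.1 (mem_coe.1 hf)
      refine hs.not_parallel hR hq he'.1 hf'.1 hne (hf'.2.1.trans he'.2.1.symm)
        (by rw [he'.2.1]; exact hjS) (hends e he) ?_
      rw [hef]
      exact hends f hf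
    have hN1N : ∀ e ∈ N1, e ∈ N := by
      intro e he
      have he' := mem_filter.1 he
      exact mem_filter.2 ⟨he'.1, i, he'.2.2, by rw [he'.2.1]; exact ⟨hj, hjS, hcard⟩⟩
    have hsum := sum_classMass_le (q := q) (q' := q1) hm (B := N1.image oth) (c := i) ?_
    · refine le_trans ?_ hsum
      rw [sum_image hinj]
      calc (600 : ℝ) * 20 ^ J ≤ N1.card * 20 ^ J := by
            gcongr
            exact_mod_cast hcard
        _ = ∑ e ∈ N1, (20 : ℝ) ^ J := by simp
        _ ≤ _ := by
            refine sum_le_sum fun e he => hAmass _ ?_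
            rcases hends e he with h | h
            · rw [← h.2]; exact (hNA e (hN1N e he)).2
            · rw [← h.1]; exact (hNA e (hN1N e he)).1
    · intro x hx
      obtain ⟨e, he, hex⟩ := mem_image.1 hx
      have hadj : Γ i (q x) := ⟨e, hN1N e he, by rw [← hex]; exact hends e he⟩
      rw [hq1A x ((hmemA _).2 ⟨_, hsymm _ _ hadj⟩)]
      exact hnb _ hadj
  have hZ : ∀ e ∈ N, P.len e ≤ 20 * 20 ^ J := by
    intro e he
    refine (hs.len_lt e).le.trans ?_
    rw [pow_succ, mul_comm]
    gcongr
    · norm_num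
    · exact (hNE e he).2.1
  have hext : ∀ {a b c : α} {r s : ℝ}, (∀ x z, q x = a → q z = b → P.Near (R ∪ N) x z r) →
      (b = c ∨ Γ b c) → r + 40 * 20 ^ J = s →
      ∀ x z, q x = a → q z = c → P.Near (R ∪ N) x z s := by
    intro a b c r s h hbc hrs x z hx hz
    rcases hbc with rfl | ⟨e, he, h' | h'⟩
    · exact (h x z hx hz).mono subset_rfl (by linarith)
    · exact (((h x _ hx h'.1).trans (near_fwd (mem_union_right _ he))).trans
        ((hq _ z (h'.2.trans hz.symm)).mono subset_union_left le_rfl)).mono subset_rfl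
        (by linarith [hZ e he])
    · exact (((h x _ hx h'.2).trans (near_bwd (mem_union_right _ he))).trans
        ((hq _ z (h'.1.trans hz.symm)).mono subset_union_left le_rfl)).mono subset_rfl
        (by linarith [hZ e he])
  have hq1diam : ∀ x y, q1 x = q1 y → P.Near (R ∪ N) x y (260 * 20 ^ J) := by
    intro x y h
    by_cases hx : q x ∈ A <;> by_cases hy : q y ∈ A
    · obtain ⟨-, -, -, -, b, c, h1, h2, h3⟩ := hg _ ((hmemA _).1 hx)
      obtain ⟨-, -, -, -, b', c', h1', h2', h3'⟩ := hg _ ((hmemA _).1 hy)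
      rw [hq1A x hx, hq1A y hy] at h
      rw [h] at h3
      have flip : ∀ {a b : α}, (a = b ∨ Γ a b) → (b = a ∨ Γ b a) :=
        fun h => h.imp Eq.symm (hsymm _ _)
      have s0 : ∀ u z, q u = q x → q z = q x → P.Near (R ∪ N) u z (20 * 20 ^ J) :=
        fun u z hu hz => (hq u z (hu.trans hz.symm)).mono subset_union_left le_rfl
      exact hext (hext (hext (hext (hext (hext s0 h1 rfl) h2 rfl) h3 rfl) (flip h3') rfl)
        (flip h2') rfl) (flip h1') (by ring) x y rfl rfl
    · exact absurd (by rw [← hq1n y hy, ← h, hq1A x hx]; exact hgA _ hx) hy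
    · exact absurd (by rw [← hq1n x hx, h, hq1A y hy]; exact hgA _ hy) hx
    · rw [hq1n x hx, hq1n y hy] at h
      exact (hq x y h).mono subset_union_left (by nlinarith)
  set m1 : α → ℝ := fun x => if q x ∈ A then
    m x * ((260 * 20 ^ J + 1) / classMass q1 m (q1 x)) else m x with hm1
  have hratio : ∀ x, q x ∈ A → 0 ≤ (260 * 20 ^ J + 1) / classMass q1 m (q1 x) ∧
      (260 * 20 ^ J + 1) / classMass q1 m (q1 x) ≤ 1 / 2 := by
    intro x hx
    have h1 := hstar _ hx
    rw [hq1A x hx]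
    have h2 : 0 < classMass q1 m (g (q x)) := by nlinarith
    exact ⟨by positivity, by rw [div_le_iff₀ h2]; nlinarith⟩
  have hm1half : ∀ x, q x ∈ A → 2 * m1 x ≤ m x := by
    intro x hx
    have := hratio x hx
    simp only [hm1, hx, if_true]
    nlinarith [hm x]
  have hm1le : ∀ x, m1 x ≤ m x := by
    intro x
    by_cases hx : q x ∈ A
    · have := hratio x hx
      simp only [hm1, hx, if_true]
      nlinarith [hm x]
    · simp [hm1, hx]
  have hm1nn : ∀ x, 0 ≤ m1 x := by
    intro x
    by_cases hx : q x ∈ A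
    · simp only [hm1, hx, if_true]
      exact mul_nonneg (hm x) (hratio x hx).1
    · simpa [hm1, hx] using hm x
  refine ⟨A, q1, m1, R ∪ N, subset_union_left, union_subset hR
    (fun e he => (mem_sdiff.1 (hNE e he).1).1), hcoarse, hq1diam, ?_, hm1nn, hm1le, hm1half,
    hAmass, ?_, ?_, ?_⟩
  · intro x y h
    by_cases hx : q x ∈ A
    · have hmass : classMass q1 m1 (q1 x) = 260 * 20 ^ J + 1 := by
        have h1 : classMass q1 m1 (q1 x) =
            classMass q1 m (q1 x) * ((260 * 20 ^ J + 1) / classMass q1 m (q1 x)) := by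
          conv_lhs => unfold classMass
          conv_rhs => enter [1]; unfold classMass
          rw [sum_mul]
          refine sum_congr rfl fun z hz => ?_
          have hz' := (mem_filter.1 hz).2
          have hzA : q z ∈ A := by
            by_contra hc
            exact hc (by rw [← hq1n z hc, hz', hq1A x hx]; exact hgA _ hx)
          simp only [hm1, hzA, if_true, hz']
        have h2 := hstar _ hx
        rw [← hq1A x hx] at h2
        rw [h1, mul_div_cancel₀]
        nlinarith
      rw [hmass]
      exact (hq1diam x y h).mono subset_rfl (by linarith)
    · have hy : q y ∉ A := fun hy => hx (by
        rw [← hq1n x hx, h, hq1A y hy]; exact hgA _ hy)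
      have hxy : q x = q y := by rw [← hq1n x hx, h, hq1n y hy]
      refine (hqm x y hxy).mono subset_union_left ?_
      have : classMass q m (q x) ≤ classMass q1 m1 (q1 x) := by
        have e1 : classMass q m (q x) = classMass q m1 (q x) := by
          unfold classMass
          refine sum_congr rfl fun z hz => ?_
          have : q z ∉ A := by rw [(mem_filter.1 hz).2]; exact hx
          simp [hm1, this]
        rw [e1]
        exact classMass_le hm1nn fun z hz => hcoarse z x hz
      linarith
  · intro e he
    have he' : e ∈ N := by
      obtain ⟨h1, h2⟩ := mem_sdiff.1 he
      exact (mem_union.1 h1).resolve_left h2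
    exact ⟨(hNA e he').1, (hNA e he').2, (hNE e he').2⟩
  · intro j hj hjS a
    by_cases hh : heavy j a
    · have : ((E \ (R ∪ N)).filter fun e => lev e = j ∧
          (q (P.src e) = a ∨ q (P.dst e) = a)) = ∅ := by
        rw [filter_eq_empty_iff]
        rintro e he ⟨h1, h2⟩
        rw [mem_sdiff, mem_union, not_or] at he
        exact he.2.2 (mem_filter.2 ⟨mem_sdiff.2 ⟨he.1, he.2.1⟩, a, h2, by rw [h1]; exact hh⟩)
      rw [this]
      simp
    · have h1 : ¬ 600 ≤ ((E \ R).filter fun e => lev e = j ∧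
          (q (P.src e) = a ∨ q (P.dst e) = a)).card := fun h => hh ⟨hj, hjS, h⟩
      refine le_trans (card_le_card (filter_subset_filter _ ?_)) (not_le.1 h1).le
      exact sdiff_subset_sdiff subset_rfl subset_union_left
  · have hsub : ∀ e ∈ ((R ∪ N) \ R).filter fun e => lev e = J, e ∈ N ∧ lev e = J := by
      intro e he
      obtain ⟨h1, h2⟩ := mem_filter.1 he
      obtain ⟨h3, h4⟩ := mem_sdiff.1 h1
      exact ⟨(mem_union.1 h3).resolve_left h4, h2⟩
    refine unit_card_le (u := fun e => q (P.src e)) (v := fun e => q (P.dst e))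
      (L := Nat.log 2 (Fintype.card α)) A _ (Nat.log_mono_right (card_le_univ A))
      (fun e he => hNA e (hsub e he).1) ?_
    intro e he
    obtain ⟨heN, heJ⟩ := hsub e he
    refine hs.not_short hR hq (hNE e heN).1 ?_ (by simp) ?_ ?_
    · intro f hf
      exact (mem_sdiff.1 (hNE f (hsub f (mem_of_mem_erase hf)).1).1).1
    · intro f hf
      rw [(hsub f (mem_of_mem_erase hf)).2, heJ]
    · rw [heJ, pow_succ]
      have := mul_le_mul_of_nonneg_right hs.log_le_tau (by positivity : (0 : ℝ) ≤ 20 ^ J)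
      nlinarith

end LinkSystem

namespace LinkSystem

variable {α ι : Type*} [Fintype α] {P : LinkSystem α ι} {E R : Finset ι} {lev : ι → ℕ}
  {S J : ℕ} {τ : ℝ} {q : α → α} {m mp : α → ℝ}

/-- State of the clustering process at scale `20 ^ J`: the partition `q`, the current and
previous potentials `m` and `mp`, and the links `R` already used for contractions. -/
structure LevelState (P : LinkSystem α ι) (E : Finset ι) (lev : ι → ℕ) (S J : ℕ) (q : α → α)
    (m mp : α → ℝ) (R : Finset ι) : Prop where
  sub : R ⊆ E
  diam : ∀ x y, q x = q y → P.Near R x y (20 * 20 ^ J)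
  diam_mass : ∀ x y, q x = q y → P.Near R x y (classMass q m (q x) - 1)
  large : (∀ x, 20 ^ J ≤ classMass q m (q x)) ∨ ∀ x y, q x = q y
  nonneg : ∀ x, 0 ≤ m x
  le_prev : ∀ x, m x ≤ mp x
  prev_le : ∀ x, mp x ≤ 1
  undone : ∀ j < J, J ≤ j + S → ∀ a, (((E \ R).filter fun e => lev e = j ∧
    (q (P.src e) = a ∨ q (P.dst e) = a)).card : ℝ) * 20 ^ J ≤ 12000 * classMass q mp a
  cost : ∑ e ∈ R, (20 : ℝ) ^ (lev e + 1) ≤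
    48080 * (Fintype.card α - ∑ x, m x) + 24000 * (Fintype.card α - ∑ x, mp x)
  late : ∑ e ∈ (E \ R).filter (fun e => lev e + S < J), (20 : ℝ) ^ (lev e + 1) ≤
    J * (12000 * Fintype.card α / 20 ^ S)

lemma LevelState.init : LevelState P E lev S 0 id (fun _ => 1) (fun _ => 1) ∅ := by
  have h1 : ∀ x : α, classMass id (fun _ => (1 : ℝ)) x = 1 := by
    intro x
    have : (univ.filter fun y : α => id y = x) = {x} := by ext y; simp
    unfold classMass
    rw [this, sum_singleton]
  refine ⟨empty_subset _, ?_, ?_, .inl ?_, by simp, by simp, by simp, by simp, by simp,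
    by simp⟩
  · rintro x y h
    obtain rfl : x = y := h
    exact .refl _ (by norm_num)
  · rintro x y h
    obtain rfl : x = y := h
    exact .refl _ (by rw [h1]; norm_num)
  · intro x
    rw [h1]; norm_num

/-- If every class meets few of the links of a scale, then so does every coarser class,
relative to its mass. -/
lemma LevelState.card_undone_le (hst : LevelState P E lev S J q m mp R)
    (hs : P.Sparse E lev S τ) {R1 : Finset ι} (hR1 : R ⊆ R1) {q2 : α → α}
    (hco : ∀ x y, q x = q y → q2 x = q2 y) {j : ℕ} (hj : J ≤ j + S)
    (hlight : ∀ a, ((E \ R1).filter fun e => lev e = j ∧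
        (q (P.src e) = a ∨ q (P.dst e) = a)).card ≤ 600) (a : α) :
    (((E \ R1).filter fun e => lev e = j ∧
      (q2 (P.src e) = a ∨ q2 (P.dst e) = a)).card : ℝ) * 20 ^ J ≤
      600 * classMass q2 m a := by
  rcases hst.large with hl | hl
  · set B : Finset α := (univ.filter fun x => q2 x = a).image q with hB
    have h1 : ((E \ R1).filter fun e => lev e = j ∧
        (q2 (P.src e) = a ∨ q2 (P.dst e) = a)).card ≤ B.card * 600 := by
      refine (card_le_card (t := B.biUnion fun b => (E \ R1).filter fun e => lev e = j ∧
        (q (P.src e) = b ∨ q (P.dst e) = b)) ?_).trans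
        (card_biUnion_le_card_mul _ _ _ fun b _ => hlight b)
      intro e he
      obtain ⟨h1, h2, h3⟩ := mem_filter.1 he
      rw [mem_biUnion]
      rcases h3 with h3 | h3
      · exact ⟨q (P.src e), mem_image.2 ⟨_, by simpa using h3, rfl⟩,
          mem_filter.2 ⟨h1, h2, .inl rfl⟩⟩
      · exact ⟨q (P.dst e), mem_image.2 ⟨_, by simpa using h3, rfl⟩,
          mem_filter.2 ⟨h1, h2, .inr rfl⟩⟩
    have h2 : ∑ b ∈ B, classMass q m b ≤ classMass q2 m a := by
      refine sum_classMass_le hst.nonneg fun x hx => ?_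
      obtain ⟨y, hy, hyx⟩ := mem_image.1 hx
      rw [← hco y x hyx]
      exact (mem_filter.1 hy).2
    have h3 : (B.card : ℝ) * 20 ^ J ≤ ∑ b ∈ B, classMass q m b := by
      rw [← nsmul_eq_mul]
      refine card_nsmul_le_sum _ _ _ fun b hb => ?_
      obtain ⟨y, -, rfl⟩ := mem_image.1 hb
      exact hl y
    have h4 : (((E \ R1).filter fun e => lev e = j ∧
        (q2 (P.src e) = a ∨ q2 (P.dst e) = a)).card : ℝ) ≤ B.card * 600 := by
      exact_mod_cast h1
    have h5 := mul_le_mul_of_nonneg_right h4 (by positivity : (0 : ℝ) ≤ 20 ^ J)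
    linarith
  · have : ((E \ R1).filter fun e => lev e = j ∧
        (q2 (P.src e) = a ∨ q2 (P.dst e) = a)) = ∅ := by
      rw [filter_eq_empty_iff]
      rintro e he ⟨h1, -⟩
      exact hs.not_inner hst.sub hst.diam (sdiff_subset_sdiff subset_rfl hR1 he)
        (by rw [h1]; exact hj) (hl _ _)
    rw [this]
    have : 0 ≤ classMass q2 m a := sum_nonneg fun x _ => hst.nonneg x
    simpa using this

lemma sum_twenty_pow_le (J : ℕ) : ∑ j ∈ range J, (20 : ℝ) ^ (j + 1) ≤ 2 * 20 ^ J := by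
  induction J with
  | zero => simp
  | succ J ih =>
    rw [sum_range_succ, pow_succ]
    have : (0 : ℝ) < 20 ^ J := by positivity
    linarith

/-- The links contracted at one scale are paid for by the drop of the potentials. -/
lemma LevelState.cost_new_le (hst : LevelState P E lev S J q m mp R) {A : Finset α}
    {m1 : α → ℝ} {R1 : Finset ι} (hR1E : R1 ⊆ E)
    (hm1le : ∀ x, m1 x ≤ m x) (hhalf : ∀ x, q x ∈ A → 2 * m1 x ≤ m x)
    (hA : ∀ a ∈ A, 20 ^ J ≤ classMass q m a)
    (hnew : ∀ e ∈ R1 \ R, q (P.src e) ∈ A ∧ q (P.dst e) ∈ A ∧ lev e ≤ J ∧ J ≤ lev e + S)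
    (htop : ((R1 \ R).filter fun e => lev e = J).card ≤ 2 * A.card) :
    ∑ e ∈ R1 \ R, (20 : ℝ) ^ (lev e + 1) ≤
      48080 * ∑ x, (m x - m1 x) + 24000 * ∑ x, (mp x - m x) := by
  set MA := ∑ x with q x ∈ A, m x with hMA
  set MP := ∑ x with q x ∈ A, mp x with hMP
  have hgain : MA ≤ 2 * ∑ x, (m x - m1 x) := by
    rw [mul_sum]
    calc MA ≤ ∑ x with q x ∈ A, 2 * (m x - m1 x) := by
          refine sum_le_sum fun x hx => ?_
          linarith [hhalf x (mem_filter.1 hx).2]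
      _ ≤ _ := sum_le_sum_of_subset_of_nonneg (filter_subset _ _)
          fun x _ _ => by linarith [hm1le x]
  have hMPle : MP ≤ MA + ∑ x, (mp x - m x) := by
    have : MP = MA + ∑ x with q x ∈ A, (mp x - m x) := by
      rw [hMP, hMA, ← sum_add_distrib]
      exact sum_congr rfl fun x _ => by ring
    rw [this]
    gcongr
    · exact fun x _ _ => by linarith [hst.le_prev x]
    · exact filter_subset _ _
  have hpow : (0 : ℝ) < 20 ^ J := by positivity
  have hMP0 : 0 ≤ MP := sum_nonneg fun x _ => (hst.nonneg x).trans (hst.le_prev x)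
  have hsplit : ∑ e ∈ R1 \ R, (20 : ℝ) ^ (lev e + 1) = ∑ j ∈ range (J + 1),
      (((R1 \ R).filter fun e => lev e = j).card : ℝ) * 20 ^ (j + 1) := by
    rw [← sum_fiberwise_of_maps_to (t := range (J + 1)) (g := lev)
      fun e he => mem_range.2 (Nat.lt_succ_of_le (hnew e he).2.2.1)]
    refine sum_congr rfl fun j _ => ?_
    rw [← nsmul_eq_mul, ← sum_const]
    exact sum_congr rfl fun e he => by rw [(mem_filter.1 he).2]
  have htop' : (((R1 \ R).filter fun e => lev e = J).card : ℝ) * 20 ^ (J + 1) ≤ 40 * MA := by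
    have h1 : (A.card : ℝ) * 20 ^ J ≤ MA := by
      rw [hMA, ← sum_classMass, ← nsmul_eq_mul]
      exact card_nsmul_le_sum _ _ _ hA
    have h2 : (((R1 \ R).filter fun e => lev e = J).card : ℝ) ≤ 2 * A.card := by
      exact_mod_cast htop
    rw [pow_succ]
    nlinarith
  have hlow : ∀ j ∈ range J, (((R1 \ R).filter fun e => lev e = j).card : ℝ) * 20 ^ J ≤
      12000 * MP := by
    intro j hj
    rw [mem_range] at hj
    by_cases hjS : J ≤ j + S
    · have h1 : ((R1 \ R).filter fun e => lev e = j).card ≤ ∑ a ∈ A,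
          ((E \ R).filter fun e => lev e = j ∧ (q (P.src e) = a ∨ q (P.dst e) = a)).card := by
        refine (card_le_card ?_).trans card_biUnion_le
        intro e he
        obtain ⟨h1, h2⟩ := mem_filter.1 he
        exact mem_biUnion.2 ⟨_, (hnew e h1).1, mem_filter.2
          ⟨sdiff_subset_sdiff hR1E subset_rfl h1, h2, .inl rfl⟩⟩
      have h2 : (((R1 \ R).filter fun e => lev e = j).card : ℝ) ≤ ∑ a ∈ A,
          (((E \ R).filter fun e => lev e = j ∧
            (q (P.src e) = a ∨ q (P.dst e) = a)).card : ℝ) := by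
        exact_mod_cast h1
      calc _ ≤ (∑ a ∈ A, (((E \ R).filter fun e => lev e = j ∧
            (q (P.src e) = a ∨ q (P.dst e) = a)).card : ℝ)) * 20 ^ J := by gcongr
        _ ≤ ∑ a ∈ A, 12000 * classMass q mp a := by
            rw [sum_mul]
            exact sum_le_sum fun a _ => hst.undone j hj hjS a
        _ = _ := by rw [← mul_sum, sum_classMass]
    · have : ((R1 \ R).filter fun e => lev e = j) = ∅ := by
        rw [filter_eq_empty_iff]
        intro e he hej
        exact hjS (hej ▸ (hnew e he).2.2.2)
      rw [this]
      simpa using hMP0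
  have hlow' : ∑ j ∈ range J, (((R1 \ R).filter fun e => lev e = j).card : ℝ) * 20 ^ (j + 1) ≤
      24000 * MP := by
    refine le_of_mul_le_mul_right ?_ hpow
    calc _ = ∑ j ∈ range J, ((((R1 \ R).filter fun e => lev e = j).card : ℝ) * 20 ^ J) *
          20 ^ (j + 1) := by
          rw [sum_mul]
          exact sum_congr rfl fun j _ => by ring
      _ ≤ ∑ j ∈ range J, (12000 * MP) * 20 ^ (j + 1) := by
          refine sum_le_sum fun j hj => ?_
          exact mul_le_mul_of_nonneg_right (hlow j hj) (by positivity)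
      _ = 12000 * MP * ∑ j ∈ range J, (20 : ℝ) ^ (j + 1) := (mul_sum _ _ _).symm
      _ ≤ 12000 * MP * (2 * 20 ^ J) := by gcongr; exact sum_twenty_pow_le J
      _ = _ := by ring
  rw [hsplit, sum_range_succ]
  linarith

lemma LevelState.step (hst : LevelState P E lev S J q m mp R) (hs : P.Sparse E lev S τ)
    (hconn : ∀ x y, ∃ r, P.Near ∅ x y r) :
    ∃ q2 m1 R1, LevelState P E lev S (J + 1) q2 m1 m R1 := by
  obtain ⟨A, q1, m1, R1, hRR, hR1E, hco1, hd1, hdm1, hnn, hle, hhalf, hA, hnew, hlight, htop⟩ :=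
    hs.exists_contraction hst.sub hst.nonneg hst.diam hst.diam_mass hst.large
  obtain ⟨q2, hco2, hdm2, hd2, hl2⟩ := exists_grouping P R1 (X := 20 * 20 ^ J)
    (Y := 260 * 20 ^ J) (by positivity) (by positivity) hnn hconn q1 hdm1
    (fun a => .inr fun x y hx hy => hd1 x y (hx.trans hy.symm))
  have hpow : (0 : ℝ) < 20 ^ J := by positivity
  have hco : ∀ x y, q x = q y → q2 x = q2 y := fun x y h => hco2 _ _ (hco1 _ _ h)
  refine ⟨q2, m1, R1, hR1E, ?_, hdm2, ?_, hnn, hle, fun x => (hst.le_prev x).trans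
    (hst.prev_le x), ?_, ?_, ?_⟩
  · intro x y h
    exact (hd2 x y h).mono subset_rfl (by rw [pow_succ]; linarith)
  · rcases hl2 with h | h
    · exact .inl fun x => by rw [pow_succ, mul_comm]; exact h x
    · exact .inr h
  · intro j hj hjS a
    have := hst.card_undone_le hs hRR hco (j := j) (by omega)
      (hlight j (by omega) (by omega)) a
    rw [pow_succ]
    linarith
  · have h1 := hst.cost_new_le hR1E hle hhalf hA hnew htop
    have h2 := hst.cost
    rw [← sum_sdiff hRR]
    rw [sum_sub_distrib, sum_sub_distrib] at h1
    linarith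
  · rcases isEmpty_or_nonempty α with hα | ⟨⟨a0⟩⟩
    · have : ∀ T : Finset ι, T = ∅ := fun T =>
        eq_empty_of_forall_notMem fun e _ => hα.elim (P.src e)
      rw [this (filter _ _), sum_empty]
      positivity
    have hnewlate : ∑ e ∈ (E \ R1).filter (fun e => lev e + S = J), (20 : ℝ) ^ (lev e + 1) ≤
        12000 * Fintype.card α / 20 ^ S := by
      by_cases hSJ : S ≤ J
      · have h1 := hst.card_undone_le hs hRR (q2 := fun _ => a0) (fun _ _ _ => rfl)
          (j := J - S) (by omega) (hlight (J - S) (by omega) (by omega)) a0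
        have h2 : classMass (fun _ => a0) m a0 ≤ Fintype.card α := by
          unfold classMass
          simp only [filter_true]
          calc _ ≤ ∑ x : α, (1 : ℝ) :=
                sum_le_sum fun x _ => (hst.le_prev x).trans (hst.prev_le x)
            _ = _ := by simp
        have h3 : ((E \ R1).filter fun e => lev e + S = J) = (E \ R1).filter fun e =>
            lev e = J - S ∧ (a0 = a0 ∨ a0 = a0) := by
          refine filter_congr fun e _ => ?_
          simp only [or_self, and_true]
          omega
        rw [← h3] at h1
        have h4 : ∑ e ∈ (E \ R1).filter (fun e => lev e + S = J), (20 : ℝ) ^ (lev e + 1) =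
            ((E \ R1).filter (fun e => lev e + S = J)).card * 20 ^ (J - S + 1) := by
          rw [← nsmul_eq_mul, ← sum_const]
          refine sum_congr rfl fun e he => ?_
          have := (mem_filter.1 he).2
          congr 2
          omega
        rw [h4, le_div_iff₀ (by positivity)]
        have h5 : (20 : ℝ) ^ (J - S + 1) * 20 ^ S = 20 * 20 ^ J := by
          rw [← pow_add, ← pow_succ']
          congr 1
          omega
        rw [mul_assoc, h5]
        linarith
      · have : ((E \ R1).filter fun e => lev e + S = J) = ∅ :=
          filter_eq_empty_iff.2 fun e _ => by omega
        rw [this, sum_empty]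
        positivity
    have hold : ∑ e ∈ (E \ R1).filter (fun e => lev e + S < J), (20 : ℝ) ^ (lev e + 1) ≤
        J * (12000 * Fintype.card α / 20 ^ S) :=
      (sum_le_sum_of_subset_of_nonneg (filter_subset_filter _
        (sdiff_subset_sdiff subset_rfl hRR)) fun _ _ _ => by positivity).trans hst.late
    have hsplit : ((E \ R1).filter fun e => lev e + S < J + 1) =
        ((E \ R1).filter fun e => lev e + S < J) ∪ (E \ R1).filter fun e => lev e + S = J := by
      rw [← filter_or]
      exact filter_congr fun e _ => by omega
    rw [hsplit, sum_union (disjoint_filter.2 fun e _ h h' => by omega)]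
    push_cast
    linarith

lemma Sparse.exists_levelState (hs : P.Sparse E lev S τ)
    (hconn : ∀ x y, ∃ r, P.Near ∅ x y r) (J : ℕ) :
    ∃ q m mp R, LevelState P E lev S J q m mp R := by
  induction J with
  | zero => exact ⟨_, _, _, _, LevelState.init⟩
  | succ J ih =>
    obtain ⟨q, m, mp, R, h⟩ := ih
    obtain ⟨q2, m1, R1, h'⟩ := h.step hs hconn
    exact ⟨_, _, _, _, h'⟩

lemma Sparse.sum_le (hs : P.Sparse E lev S τ) (hconn : ∀ x y, ∃ r, P.Near ∅ x y r) {J : ℕ}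
    (hJ : ∀ e ∈ E, lev e + S < J) :
    ∑ e ∈ E, P.len e ≤ 72080 * Fintype.card α + J * (12000 * Fintype.card α / 20 ^ S) := by
  obtain ⟨q, m, mp, R, h⟩ := hs.exists_levelState hconn J
  have h1 := h.cost
  have h2 := h.late
  rw [filter_true_of_mem fun e he => hJ e (mem_sdiff.1 he).1] at h2
  have h3 : 0 ≤ ∑ x, m x := sum_nonneg fun x _ => h.nonneg x
  have h4 : ∑ x, m x ≤ ∑ x, mp x := sum_le_sum fun x _ => h.le_prev x
  calc ∑ e ∈ E, P.len e ≤ ∑ e ∈ E, (20 : ℝ) ^ (lev e + 1) :=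
        sum_le_sum fun e _ => (hs.len_lt e).le
    _ ≤ _ := by
        rw [← sum_sdiff h.sub]
        linarith

/-- Every finite link system whose base has diameter at most its number of points has a
set of links of linear total length approximating all links within a logarithmic factor. -/
theorem exists_light_links [Fintype ι] (P : LinkSystem α ι)
    (hdiam : ∀ x y, P.Near ∅ x y (Fintype.card α)) :
    ∃ E : Finset ι, ∑ e ∈ E, P.len e ≤ 100000 * Fintype.card α ∧
      ∀ c, P.Near E (P.src c) (P.dst c)
        (1000 * (Nat.log 2 (Fintype.card α) + 1) * P.len c) := by
  set n := Fintype.card α with hn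
  set N : ℕ := Nat.log 2 n + 1 with hN
  have hN1 : (1 : ℝ) ≤ N := by simp [hN]
  have hNcast : (N : ℝ) = Nat.log 2 n + 1 := by simp [hN]
  obtain ⟨E, hE1, hE2⟩ := exists_greedy P (t := 1000 * N) (by linarith)
  refine ⟨E, ?_, fun c => by rw [← hNcast]; exact hE1 c⟩
  set S : ℕ := Nat.log 20 N + 1 with hS
  have hS1 : N < 20 ^ S := Nat.lt_pow_succ_log_self (by norm_num) N
  have hS2 : 20 ^ S ≤ 20 * N := by
    rw [hS, pow_succ, mul_comm]
    exact Nat.mul_le_mul_left _ (Nat.pow_log_le_self 20 (by omega))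
  have hS1' : (N : ℝ) < 20 ^ S := by exact_mod_cast hS1
  have hS2' : (20 : ℝ) ^ S ≤ 20 * N := by exact_mod_cast hS2
  have hlev : ∀ e, ∃ k : ℕ, (20 : ℝ) ^ k ≤ P.len e ∧ P.len e < 20 ^ (k + 1) := fun e =>
    exists_nat_pow_near (P.one_le_len e) (by norm_num)
  choose lev hlev1 hlev2 using hlev
  have hs : P.Sparse E lev S (1000 * N - 1) :=
    ⟨hlev1, hlev2, hE2, by linarith, by rw [← hn]; linarith⟩
  have hJ : ∀ e ∈ E, lev e + S < N + S := by
    intro e he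
    by_contra hcon
    have hNe : N ≤ lev e := by omega
    refine hE2 e he ((hdiam _ _).mono (empty_subset _) ?_)
    have h1 : (n : ℝ) < 2 ^ N := by
      exact_mod_cast Nat.lt_pow_succ_log_self (by norm_num) n
    have h2 : (2 : ℝ) ^ N ≤ 20 ^ N := by gcongr; norm_num
    have h3 : (20 : ℝ) ^ N ≤ 20 ^ lev e := pow_le_pow_right₀ (by norm_num) hNe
    have h4 := hlev1 e
    have h5 := P.one_le_len e
    nlinarith
  have hsum := hs.sum_le (fun x y => ⟨_, hdiam x y⟩) hJ
  have hSS : (S : ℝ) ≤ 20 ^ S := by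
    exact_mod_cast (Nat.lt_pow_self (by norm_num : 1 < 20)).le
  have hlate : ((N + S : ℕ) : ℝ) * (12000 * n / 20 ^ S) ≤ 24000 * n := by
    rw [← mul_div_assoc, div_le_iff₀ (by positivity)]
    push_cast
    have : (0 : ℝ) ≤ n := by positivity
    nlinarith
  have : (0 : ℝ) ≤ n := by positivity
  linarith

end LinkSystem

/-- A relation that behaves like the existence of a walk of length at most `r` from `u` to `v`. -/
structure WalkRel {V : Type*} (N : V → V → ℝ → Prop) : Prop where
  refl : ∀ u r, 0 ≤ r → N u u r
  symm : ∀ u v r, N u v r → N v u r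
  trans : ∀ u v x r s, N u v r → N v x s → N u x (r + s)
  mono : ∀ u v r s, N u v r → r ≤ s → N u v s

/-- Disjoint intervals in an interval have bounded total length. -/
lemma sum_radius_le {V : Type*} {f δ : V → ℝ} {lo : ℝ} (s : Finset V)
    (hlo : ∀ x ∈ s, lo ≤ f x - δ x)
    (hs : ∀ x ∈ s, ∀ y ∈ s, x ≠ y → δ x + δ y ≤ |f x - f y|) :
    ∀ hi, lo ≤ hi → (∀ x ∈ s, f x + δ x ≤ hi) → ∑ x ∈ s, 2 * δ x ≤ hi - lo := by
  induction s using Finset.induction_on_max_value f with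
  | empty => intro hi h _; simpa using h
  | insert a s ha hmax ih =>
    intro hi _ hhi
    rw [sum_insert ha]
    have h1 := ih (fun x hx => hlo x (mem_insert_of_mem hx))
      (fun x hx y hy => hs x (mem_insert_of_mem hx) y (mem_insert_of_mem hy)) (f a - δ a)
      (hlo a (mem_insert_self _ _)) (fun x hx => by
        have h2 := hs a (mem_insert_self _ _) x (mem_insert_of_mem hx)
          (fun h => ha (h ▸ hx))
        rw [abs_of_nonneg (by linarith [hmax x hx])] at h2
        linarith)
    linarith [hhi a (mem_insert_self _ _)]

section Metric

variable {V : Type*} [Fintype V] {d : V → V → ℝ} {f : V → ℝ} {Λ : ℝ} {K : Finset V}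

/-- A few pairs suffice to bring every point close to a terminal. -/
lemma exists_light_to_terminals (hd0 : ∀ u v, 0 ≤ d u v) (hsymm : ∀ u v, d u v = d v u)
    (htri : ∀ u v x, d u x ≤ d u v + d v x) (hdf : ∀ u v, d u v ≤ |f u - f v|)
    (hf0 : ∀ u, 0 ≤ f u) (hf1 : ∀ u, f u ≤ Λ) (hK : K.Nonempty) :
    ∃ Q : Finset (V × V), ∑ p ∈ Q, d p.1 p.2 ≤ 3 * Λ ∧
      ∀ N : V → V → ℝ → Prop, WalkRel N → (∀ u v, N u v |f u - f v|) →
        (∀ p ∈ Q, N p.1 p.2 (2 * d p.1 p.2)) →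
        ∀ v, ∃ κ ∈ K, (∀ u ∈ K, N v κ (4 * d v u)) ∧ ∀ u ∈ K, d v κ ≤ 3 * d v u := by
  have hnear : ∀ v, ∃ κ ∈ K, ∀ u ∈ K, d v κ ≤ d v u := fun v =>
    K.exists_min_image (d v) hK
  choose κ hκK hκ using hnear
  set D : V → ℝ := fun v => d v (κ v) with hD
  have hD0 : ∀ v, 0 ≤ D v := fun v => hd0 _ _
  have hLip : ∀ v b, D b ≤ D v + |f v - f b| := by
    intro v b
    have h1 := hκ b (κ v) (hκK v)
    have h2 := htri b v (κ v)
    have h3 := hdf v b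
    rw [hsymm] at h3
    simp only [hD]
    linarith
  have hDle : ∀ v, D v ≤ Λ := by
    intro v
    refine (hdf _ _).trans (abs_le.2 ⟨?_, ?_⟩) <;>
      linarith [hf0 v, hf1 v, hf0 (κ v), hf1 (κ v)]
  set good : Finset V → Prop := fun I =>
    ∀ x ∈ I, ∀ y ∈ I, x ≠ y → D x / 4 + D y / 4 ≤ |f x - f y| with hgood
  obtain ⟨I, hI, hmax⟩ := (univ.filter good).exists_max_image card
    ⟨∅, mem_filter.2 ⟨mem_univ _, by simp [hgood]⟩⟩
  have hI := (mem_filter.1 hI).2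
  have hcov : ∀ v, ∃ b ∈ I, |f v - f b| ≤ D v / 4 + D b / 4 := by
    intro v
    by_contra hcon
    push Not at hcon
    have hnot : v ∉ I := fun hmem => by
      have := hcon v hmem
      simp only [sub_self, abs_zero] at this
      linarith [hD0 v]
    have := hmax (insert v I) (mem_filter.2 ⟨mem_univ _, ?_⟩)
    · rw [card_insert_of_notMem hnot] at this
      omega
    · intro x hx y hy hxy
      rcases mem_insert.1 hx with hx' | hx' <;> rcases mem_insert.1 hy with hy' | hy'
      · exact absurd (hx'.trans hy'.symm) hxy
      · rw [hx']; exact (hcon y hy').le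
      · rw [hy', abs_sub_comm, add_comm]; exact (hcon x hx').le
      · exact hI x hx' y hy' hxy
  refine ⟨I.image fun b => (b, κ b), ?_, ?_⟩
  · rw [sum_image (fun x _ y _ h => (Prod.ext_iff.1 h).1)]
    obtain ⟨a, -⟩ := hK
    have hΛ : 0 ≤ Λ := (hf0 a).trans (hf1 a)
    have h1 := sum_radius_le (f := f) (δ := fun v => D v / 4) (lo := -(Λ / 4)) I
      (fun x _ => by linarith [hf0 x, hDle x]) hI (5 * Λ / 4) (by linarith)
      (fun x _ => by linarith [hf1 x, hDle x])
    rw [← mul_sum, ← sum_div] at h1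
    simp only [hD] at h1
    linarith
  · intro N hN hNf hNQ v
    obtain ⟨b, hb, hvb⟩ := hcov v
    have h1 := hLip v b
    have h2 : N b (κ b) (2 * D b) := hNQ (b, κ b) (mem_image.2 ⟨b, hb, rfl⟩)
    have h3 := htri v b (κ b)
    have h4 := hdf v b
    refine ⟨κ b, hκK b, fun u hu => ?_, fun u hu => ?_⟩
    · have h5 : D v ≤ d v u := hκ v u hu
      exact hN.mono _ _ _ _ (hN.trans _ _ _ _ _ (hNf v b) h2) (by linarith)
    · have h5 : D v ≤ d v u := hκ v u hu
      have h6 : d b (κ b) = D b := rfl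
      linarith [hD0 v]

/-- The path with vertices `0, …, n - 1` as base of a link system. -/
noncomputable def lineSystem {ι : Type*} (n : ℕ) (src dst : ι → Fin n) (len : ι → ℝ)
    (h : ∀ e, 1 ≤ len e) : LinkSystem (Fin n) ι where
  base x y := (x : ℕ) + 1 = y ∨ (y : ℕ) + 1 = x
  base_symm _ _ h := h.symm
  src := src
  dst := dst
  len := len
  one_le_len := h

lemma lineSystem_near {ι : Type*} {n : ℕ} {src dst : ι → Fin n} {len : ι → ℝ}
    {h : ∀ e, 1 ≤ len e} (x y : Fin n) : (lineSystem n src dst len h).Near ∅ x y n := by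
  have key : ∀ k : ℕ, ∀ x y : Fin n, (x : ℕ) + k = y →
      (lineSystem n src dst len h).Near ∅ x y k := by
    intro k
    induction k with
    | zero =>
      intro x y hxy
      obtain rfl : x = y := Fin.ext (by simpa using hxy)
      exact .refl _ (by simp)
    | succ k ih =>
      intro x y hxy
      have hy := y.2
      refine .base ⟨x + k, by omega⟩ _ k _ (ih _ _ rfl) (.inl ?_) (by push_cast; rfl)
      simpa [add_assoc] using hxy
  have hx := x.2
  have hy := y.2
  rcases le_total (x : ℕ) y with hxy | hxy
  · refine (key (y - x) x y (by omega)).mono subset_rfl ?_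
    exact_mod_cast (by omega : (y : ℕ) - x ≤ n)
  · refine ((key (x - y) y x (by omega)).mono subset_rfl ?_).symm
    exact_mod_cast (by omega : (x : ℕ) - y ≤ n)

/-- A few pairs suffice to approximate all distances between terminals. -/
lemma exists_light_terminal_metric (hd0 : ∀ u v, 0 ≤ d u v)
    (hf0 : ∀ u, 0 ≤ f u) (hf1 : ∀ u, f u ≤ Λ) (hΛ : 0 < Λ) (hK : K.Nonempty) :
    ∃ Q : Finset (V × V), ∑ p ∈ Q, d p.1 p.2 ≤ 200001 * Λ ∧
      ∀ N : V → V → ℝ → Prop, WalkRel N → (∀ u v, N u v |f u - f v|) →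
        (∀ p ∈ Q, N p.1 p.2 (2 * d p.1 p.2)) →
        ∀ u ∈ K, ∀ v ∈ K, N u v (8002 * (Nat.log 2 K.card + 1) * d u v) := by
  set k := K.card with hk
  have hk0 : 1 ≤ k := card_pos.2 hK
  have hk0' : (1 : ℝ) ≤ k := by exact_mod_cast hk0
  set η : ℝ := Λ / k ^ 2 with hη
  have hη0 : 0 < η := by positivity
  have hηk : η * k ^ 2 = Λ := by rw [hη]; field_simp
  have hfη : ∀ u, f u / η ≤ k ^ 2 := fun u => by
    rw [div_le_iff₀ hη0, mul_comm, hηk]; exact hf1 u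
  have hgrid : ∀ u, ⌊f u / η⌋₊ < k ^ 2 + 1 := fun u => by
    refine Nat.lt_succ_of_le (Nat.floor_le_of_le ?_)
    push_cast
    exact hfη u
  set grid : V → Fin (k ^ 2 + 1) := fun u => ⟨⌊f u / η⌋₊, hgrid u⟩ with hgriddef
  have hgf : ∀ u, |f u / η - (grid u : ℕ)| ≤ 1 := fun u => by
    have h1 := Nat.floor_le (div_nonneg (hf0 u) hη0.le)
    have h2 := (Nat.lt_floor_add_one (f u / η)).le
    simp only [hgriddef]
    rw [abs_le]
    constructor <;> linarith
  let ι := {p : V × V // p.1 ∈ K ∧ p.2 ∈ K ∧ η ≤ d p.1 p.2}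
  set P := lineSystem (ι := ι) (k ^ 2 + 1) (fun p => grid p.1.1) (fun p => grid p.1.2)
    (fun p => d p.1.1 p.1.2 / η) (fun p => (one_le_div hη0).2 p.2.2.2) with hP
  obtain ⟨E, hE1, hE2⟩ := P.exists_light_links (fun x y => by
    rw [Fintype.card_fin]; exact lineSystem_near x y)
  rw [Fintype.card_fin] at hE1 hE2
  set Q0 : Finset (V × V) := (K ×ˢ K).filter fun p => d p.1 p.2 < η with hQ0
  refine ⟨E.image Subtype.val ∪ Q0, ?_, ?_⟩
  · have h1 : ∑ p ∈ E.image Subtype.val, d p.1 p.2 ≤ 200000 * Λ := by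
      rw [sum_image (fun x _ y _ h => Subtype.ext h)]
      have h2 : ∑ e ∈ E, d e.1.1 e.1.2 = η * ∑ e ∈ E, P.len e := by
        rw [mul_sum]
        refine sum_congr rfl fun e _ => ?_
        change _ = η * (d e.1.1 e.1.2 / η)
        field_simp
      rw [h2, ← hηk]
      push_cast at hE1
      have h3 := mul_le_mul_of_nonneg_left hE1 hη0.le
      have h4 := mul_le_mul_of_nonneg_left (one_le_pow₀ hk0' : (1 : ℝ) ≤ k ^ 2) hη0.le
      linarith
    have h2 : ∑ p ∈ Q0, d p.1 p.2 ≤ Λ := by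
      calc ∑ p ∈ Q0, d p.1 p.2 ≤ ∑ p ∈ Q0, η :=
            sum_le_sum fun p hp => (mem_filter.1 hp).2.le
        _ = Q0.card * η := by simp
        _ ≤ (k ^ 2 : ℕ) * η := by
            gcongr
            refine (card_filter_le _ _).trans ?_
            rw [card_product, sq]
        _ = Λ := by rw [mul_comm]; push_cast; exact hηk
    calc _ ≤ ∑ p ∈ E.image Subtype.val, d p.1 p.2 + ∑ p ∈ Q0, d p.1 p.2 := by
          rw [← sum_union_inter]
          linarith [sum_nonneg fun p (_ : p ∈ E.image Subtype.val ∩ Q0) => hd0 p.1 p.2]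
      _ ≤ _ := by linarith
  · intro N hN hNf hNQ u hu v hv
    have hlog0 : (0 : ℝ) ≤ Nat.log 2 k := by positivity
    by_cases hsmall : d u v < η
    · refine hN.mono _ _ _ _ (hNQ (u, v) (mem_union_right _ (mem_filter.2
        ⟨mem_product.2 ⟨hu, hv⟩, hsmall⟩))) ?_
      have := hd0 u v
      nlinarith
    · have hbig : η ≤ d u v := not_lt.1 hsmall
      have hfline : ∀ a b : V, ∀ y : ℝ, |f a / η - y| ≤ 1 →
          N a b (η * (1 + |f b / η - y|)) := by
        intro a b y h
        refine hN.mono _ _ _ _ (hNf a b) ?_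
        have h1 : |f a - f b| = η * |f a / η - f b / η| := by
          rw [← abs_of_pos hη0, ← abs_mul, abs_of_pos hη0]
          congr 1
          field_simp
        rw [h1]
        have h2 := abs_sub_le (f a / η) y (f b / η)
        rw [abs_sub_comm y] at h2
        gcongr
        linarith
      have key : ∀ y r, P.Near E (grid u) y r → ∀ b,
          N u b (η * (4 * r + 1 + |f b / η - (y : ℕ)|)) := by
        intro y r h
        induction h with
        | refl r hr =>
          intro b
          refine hN.mono _ _ _ _ (hfline u b _ (hgf u)) ?_
          gcongr
          linarith
        | base y z r s _ hb hs ih =>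
          intro b
          refine hN.mono _ _ _ _ (ih b) ?_
          have h1 : |((z : ℕ) : ℝ) - (y : ℕ)| ≤ 1 := by
            rcases hb with h | h <;> rw [← h] <;> push_cast <;> simp
          have h2 := abs_sub_le (f b / η) (z : ℕ) (y : ℕ)
          exact mul_le_mul_of_nonneg_left (by linarith) hη0.le
        | fwd e r s _ he hs ih =>
          intro b
          have h1 := ih e.1.1
          have h2 := hNQ e.1 (mem_union_left _ (mem_image.2 ⟨e, he, rfl⟩))
          have h3 := hfline e.1.2 b _ (hgf e.1.2)
          refine hN.mono _ _ _ _ (hN.trans _ _ _ _ _ (hN.trans _ _ _ _ _ h1 h2) h3) ?_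
          have h4 : |f e.1.1 / η - (P.src e : ℕ)| ≤ 1 := hgf e.1.1
          have h5 : P.len e = d e.1.1 e.1.2 / η := rfl
          have h6 : P.dst e = grid e.1.2 := rfl
          have h7 := P.one_le_len e
          have h8 : d e.1.1 e.1.2 = η * P.len e := by rw [h5]; field_simp
          rw [h8, h6]
          have : η * (4 * r + 1 + |f e.1.1 / η - (P.src e : ℕ)|) + 2 * (η * P.len e) +
              η * (1 + |f b / η - (grid e.1.2 : ℕ)|) = η * (4 * r + 1 +
              |f e.1.1 / η - (P.src e : ℕ)| + 2 * P.len e + 1 +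
              |f b / η - (grid e.1.2 : ℕ)|) := by ring
          rw [this]
          refine mul_le_mul_of_nonneg_left ?_ hη0.le
          linarith
        | bwd e r s _ he hs ih =>
          intro b
          have h1 := ih e.1.2
          have h2 := hN.symm _ _ _ (hNQ e.1 (mem_union_left _ (mem_image.2 ⟨e, he, rfl⟩)))
          have h3 := hfline e.1.1 b _ (hgf e.1.1)
          refine hN.mono _ _ _ _ (hN.trans _ _ _ _ _ (hN.trans _ _ _ _ _ h1 h2) h3) ?_
          have h4 : |f e.1.2 / η - (P.dst e : ℕ)| ≤ 1 := hgf e.1.2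
          have h5 : P.len e = d e.1.1 e.1.2 / η := rfl
          have h6 : P.src e = grid e.1.1 := rfl
          have h7 := P.one_le_len e
          have h8 : d e.1.1 e.1.2 = η * P.len e := by rw [h5]; field_simp
          rw [h8, h6]
          have : η * (4 * r + 1 + |f e.1.2 / η - (P.dst e : ℕ)|) + 2 * (η * P.len e) +
              η * (1 + |f b / η - (grid e.1.1 : ℕ)|) = η * (4 * r + 1 +
              |f e.1.2 / η - (P.dst e : ℕ)| + 2 * P.len e + 1 +
              |f b / η - (grid e.1.1 : ℕ)|) := by ring
          rw [this]
          refine mul_le_mul_of_nonneg_left ?_ hη0.le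
          linarith
      have hlog : Nat.log 2 (k ^ 2 + 1) ≤ 2 * Nat.log 2 k + 1 := by
        refine Nat.lt_succ_iff.1 (Nat.log_lt_of_lt_pow (by omega) ?_)
        have h1 := Nat.lt_pow_succ_log_self (b := 2) (by norm_num) k
        have h2 : 2 ^ (2 * Nat.log 2 k + 1).succ = (2 ^ (Nat.log 2 k).succ) ^ 2 := by
          rw [← pow_mul]; congr 1; omega
        rw [h2]
        nlinarith
      have hlog' : (Nat.log 2 (k ^ 2 + 1) : ℝ) ≤ 2 * Nat.log 2 k + 1 := by exact_mod_cast hlog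
      refine hN.mono _ _ _ _ (key _ _ (hE2 ⟨(u, v), hu, hv, hbig⟩) v) ?_
      have h1 : |f v / η - (P.dst ⟨(u, v), hu, hv, hbig⟩ : ℕ)| ≤ 1 := hgf v
      have h2 : P.len ⟨(u, v), hu, hv, hbig⟩ = d u v / η := rfl
      rw [h2]
      have h3 : η * (d u v / η) = d u v := by field_simp
      have h4 : 0 ≤ d u v / η := by have := hd0 u v; positivity
      calc _ ≤ η * (4 * (1000 * (2 * Nat.log 2 k + 1 + 1) * (d u v / η)) + 1 + 1) := by
            gcongr
        _ = 4000 * (2 * Nat.log 2 k + 2) * (η * (d u v / η)) + 2 * η := by ring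
        _ ≤ _ := by
          rw [h3]
          have := hd0 u v
          nlinarith

/-- A few pairs suffice to approximate all distances from terminals. -/
lemma exists_light_terminal_pairs (hd0 : ∀ u v, 0 ≤ d u v) (hsymm : ∀ u v, d u v = d v u)
    (htri : ∀ u v x, d u x ≤ d u v + d v x) (hdf : ∀ u v, d u v ≤ |f u - f v|)
    (hf0 : ∀ u, 0 ≤ f u) (hf1 : ∀ u, f u ≤ Λ) (hK : K.Nonempty) :
    ∃ Q : Finset (V × V), ∑ p ∈ Q, d p.1 p.2 ≤ 300000 * Λ ∧
      ∀ N : V → V → ℝ → Prop, WalkRel N → (∀ u v, N u v |f u - f v|) →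
        (∀ p ∈ Q, N p.1 p.2 (2 * d p.1 p.2)) →
        ∀ u ∈ K, ∀ v, N u v (40000 * (Nat.log 2 K.card + 1) * d u v) := by
  obtain ⟨a, ha⟩ := id hK
  have hΛ0 : 0 ≤ Λ := (hf0 a).trans (hf1 a)
  rcases hΛ0.eq_or_lt with hΛ | hΛ
  · refine ⟨∅, by simpa using hΛ0, fun N hN hNf _ u _ v => ?_⟩
    refine hN.mono _ _ _ _ (hNf u v) ?_
    have h1 : f u = 0 := le_antisymm (hΛ ▸ hf1 u) (hf0 u)
    have h2 : f v = 0 := le_antisymm (hΛ ▸ hf1 v) (hf0 v)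
    rw [h1, h2]
    have := hd0 u v
    simp only [sub_self, abs_zero]
    positivity
  obtain ⟨Q1, h1, h1'⟩ := exists_light_to_terminals hd0 hsymm htri hdf hf0 hf1 hK
  obtain ⟨Q2, h2, h2'⟩ := exists_light_terminal_metric hd0 hf0 hf1 hΛ hK
  refine ⟨Q1 ∪ Q2, ?_, fun N hN hNf hNQ u hu v => ?_⟩
  · calc _ ≤ ∑ p ∈ Q1, d p.1 p.2 + ∑ p ∈ Q2, d p.1 p.2 := by
          rw [← sum_union_inter]
          linarith [sum_nonneg fun p (_ : p ∈ Q1 ∩ Q2) => hd0 p.1 p.2]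
      _ ≤ _ := by linarith
  · obtain ⟨κ, hκ, h3, h4⟩ := h1' N hN hNf (fun p hp => hNQ p (mem_union_left _ hp)) v
    have h5 := h2' N hN hNf (fun p hp => hNQ p (mem_union_right _ hp)) u hu κ hκ
    refine hN.mono _ _ _ _ (hN.trans _ _ _ _ _ h5 (hN.symm _ _ _ (h3 u hu))) ?_
    have h6 := h4 u hu
    have h7 := htri u v κ
    have h8 := hd0 u v
    rw [hsymm v u] at h6 ⊢
    have h9 : (0 : ℝ) ≤ Nat.log 2 K.card := by positivity
    calc _ ≤ 8002 * (Nat.log 2 K.card + 1) * (4 * d u v) + 4 * d u v := by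
          gcongr
          linarith
      _ ≤ _ := by nlinarith

end Metric

lemma sum_biUnion_le_sum {α β : Type*} [DecidableEq β] {f : β → ℝ} (s : Finset α) (t : α → Finset β)
    (hf : ∀ e ∈ s.biUnion t, 0 ≤ f e) :
    ∑ e ∈ s.biUnion t, f e ≤ ∑ a ∈ s, ∑ e ∈ t a, f e := by
  induction s using Finset.induction_on with
  | empty => simp
  | insert a s ha ih =>
    rw [biUnion_insert] at hf
    rw [biUnion_insert, sum_insert ha]
    have h1 := ih fun e he => hf e (mem_union_right _ he)
    have h2 := sum_union_inter (s₁ := t a) (s₂ := s.biUnion t) (f := f)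
    have h3 := sum_nonneg fun e (he : e ∈ t a ∩ s.biUnion t) =>
      hf e (mem_union_left _ (mem_inter.1 he).1)
    linarith

section Graph

variable {V : Type*} {G H T : SimpleGraph V} {w w' : Sym2 V → ℝ}

/-- There is a walk of weight at most `r` from `u` to `v`. -/
def HasWalk (G : SimpleGraph V) (w : Sym2 V → ℝ) (u v : V) (r : ℝ) : Prop :=
  ∃ p : G.Walk u v, (p.edges.map w).sum ≤ r

lemma walkRel_hasWalk : WalkRel (HasWalk G w) where
  refl u r hr := ⟨.nil, by simpa using hr⟩
  symm := by
    rintro u v r ⟨p, hp⟩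
    exact ⟨p.reverse, by simpa using hp⟩
  trans := by
    rintro u v x r s ⟨p, hp⟩ ⟨q, hq⟩
    exact ⟨p.append q, by simpa using add_le_add hp hq⟩
  mono := by
    rintro u v r s ⟨p, hp⟩ hrs
    exact ⟨p, hp.trans hrs⟩

lemma HasWalk.of_adj {u v : V} (h : G.Adj u v) : HasWalk G w u v (w s(u, v)) :=
  ⟨.cons h .nil, by simp⟩

lemma HasWalk.mono_graph {u v : V} {r : ℝ} (h : HasWalk G w u v r) (hGH : G ≤ H) :
    HasWalk H w u v r := by
  obtain ⟨p, hp⟩ := h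
  exact ⟨p.mapLe hGH, by simpa using hp⟩

lemma HasWalk.of_edges_mem {u v : V} (p : G.Walk u v) (hp : ∀ e ∈ p.edges, e ∈ H.edgeSet) :
    HasWalk H w u v (p.edges.map w).sum :=
  ⟨p.transfer H hp, by simp⟩

lemma weight_le_weight (hw : ∀ e ∈ G.edgeSet, w e ≤ w' e) {u v : V} (p : G.Walk u v) :
    (p.edges.map w).sum ≤ (p.edges.map w').sum :=
  List.sum_le_sum fun e he => hw e (p.edges_subset_edgeSet he)

lemma weight_nonneg (hw : ∀ e ∈ G.edgeSet, 0 < w e) {u v : V} (p : G.Walk u v) :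
    0 ≤ (p.edges.map w).sum := by
  refine List.sum_nonneg fun x hx => ?_
  obtain ⟨e, he, rfl⟩ := List.mem_map.1 hx
  exact (hw e (p.edges_subset_edgeSet he)).le

lemma wdist_nonneg (hw : ∀ e ∈ G.edgeSet, 0 < w e) (u v : V) : 0 ≤ wdist G w u v := by
  refine Real.sInf_nonneg ?_
  rintro x ⟨p, rfl⟩
  exact weight_nonneg hw p

lemma HasWalk.wdist_le (hw : ∀ e ∈ G.edgeSet, 0 < w e) {u v : V} {r : ℝ}
    (h : HasWalk G w u v r) : wdist G w u v ≤ r := by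
  obtain ⟨p, hp⟩ := h
  have hmem : (p.edges.map w).sum ∈ {x | ∃ p : G.Walk u v, x = (p.edges.map w).sum} := ⟨p, rfl⟩
  refine (csInf_le ⟨0, ?_⟩ hmem).trans hp
  rintro x ⟨q, rfl⟩
  exact weight_nonneg hw q

lemma le_wdist (hG : G.Connected) {u v : V} {r : ℝ}
    (h : ∀ p : G.Walk u v, r ≤ (p.edges.map w).sum) : r ≤ wdist G w u v := by
  obtain ⟨p⟩ := hG.preconnected u v
  refine le_csInf ⟨_, p, rfl⟩ ?_
  rintro x ⟨q, rfl⟩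
  exact h q

lemma hasWalk_of_wdist_lt (hG : G.Connected) {u v : V} {r : ℝ} (h : wdist G w u v < r) :
    HasWalk G w u v r := by
  obtain ⟨p⟩ := hG.preconnected u v
  have hmem : (p.edges.map w).sum ∈ {x | ∃ p : G.Walk u v, x = (p.edges.map w).sum} := ⟨p, rfl⟩
  obtain ⟨x, ⟨q, rfl⟩, hx⟩ := exists_lt_of_csInf_lt ⟨_, hmem⟩ h
  exact ⟨q, hx.le⟩

lemma wdist_symm (hG : G.Connected) (hw : ∀ e ∈ G.edgeSet, 0 < w e) (u v : V) :
    wdist G w u v = wdist G w v u := by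
  have key : ∀ u v, wdist G w u v ≤ wdist G w v u := fun u v =>
    le_of_forall_gt_imp_ge_of_dense fun _ hr =>
      (walkRel_hasWalk.symm _ _ _ (hasWalk_of_wdist_lt hG hr)).wdist_le hw
  exact le_antisymm (key u v) (key v u)

lemma wdist_triangle (hG : G.Connected) (hw : ∀ e ∈ G.edgeSet, 0 < w e) (u v x : V) :
    wdist G w u x ≤ wdist G w u v + wdist G w v x := by
  refine le_of_forall_pos_le_add fun ε hε => ?_
  have h1 := hasWalk_of_wdist_lt hG (lt_add_of_pos_right (wdist G w u v) (half_pos hε))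
  have h2 := hasWalk_of_wdist_lt hG (lt_add_of_pos_right (wdist G w v x) (half_pos hε))
  have := (walkRel_hasWalk.trans _ _ _ _ _ h1 h2).wdist_le hw
  linarith

lemma wdist_le_mul_wdist (hG : G.Connected) (hw' : ∀ e ∈ G.edgeSet, 0 < w' e) {c : ℝ}
    (hc : 0 < c) (h : ∀ e ∈ G.edgeSet, w' e ≤ c * w e) (u v : V) :
    wdist G w' u v ≤ c * wdist G w u v := by
  rw [← div_le_iff₀' hc]
  refine le_wdist hG fun p => ?_
  rw [div_le_iff₀' hc, ← List.sum_map_mul_left]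
  exact HasWalk.wdist_le hw' ⟨p, weight_le_weight h p⟩

section Fintype

variable [Fintype V]

lemma wdist_pos (hG : G.Connected) (hw : ∀ e ∈ G.edgeSet, 0 < w e) {u v : V} (huv : u ≠ v) :
    0 < wdist G w u v := by
  obtain ⟨m, hm, hmw⟩ : ∃ m, 0 < m ∧ ∀ e ∈ G.edgeSet, m ≤ w e := by
    rcases G.edgeSet.eq_empty_or_nonempty with h | h
    · exact ⟨1, one_pos, by simp [h]⟩
    · obtain ⟨e, he, hmin⟩ := G.edgeSet.toFinite.exists_minimalFor w _ h
      refine ⟨w e, hw e he, fun e' he' => ?_⟩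
      rcases le_total (w e) (w e') with h' | h'
      · exact h'
      · exact hmin he' h'
  refine hm.trans_le (le_wdist hG fun p => ?_)
  cases p with
  | nil => exact absurd rfl huv
  | cons h q =>
    have := weight_nonneg hw q
    have := hmw _ ((SimpleGraph.mem_edgeSet G).2 h)
    simp only [SimpleGraph.Walk.edges_cons, List.map_cons, List.sum_cons]
    linarith

lemma hasWalk_two_mul_wdist (hG : G.Connected) (hw : ∀ e ∈ G.edgeSet, 0 < w e) (u v : V) :
    HasWalk G w u v (2 * wdist G w u v) := by
  by_cases huv : u = v
  · subst huv
    exact walkRel_hasWalk.refl _ _ (by have := wdist_nonneg hw u u; positivity)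
  · have := wdist_pos hG hw huv
    exact hasWalk_of_wdist_lt hG (by linarith)

/-- A connected graph embeds in the line with an expanding map of small image. -/
lemma exists_expanding_map (hT : T.Connected) (hw : ∀ e ∈ T.edgeSet, 0 < w e) :
    ∃ f : V → ℝ, (∀ u, 0 ≤ f u) ∧ (∀ u, f u ≤ 2 * wWeight T w) ∧
      ∀ u v, HasWalk T w u v |f u - f v| := by
  obtain ⟨a⟩ := hT.nonempty
  have key : ∀ k, 1 ≤ k → k ≤ Fintype.card V → ∃ (S : Finset V) (F : Finset (Sym2 V)) (f : V → ℝ),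
      S.card = k ∧ F ⊆ T.edgeSet.toFinite.toFinset ∧ (∀ e ∈ F, ∀ x ∈ e, x ∈ S) ∧
      (∀ u ∈ S, 0 ≤ f u ∧ f u ≤ 2 * ∑ e ∈ F, w e) ∧
      ∀ u ∈ S, ∀ v ∈ S, HasWalk T w u v |f u - f v| := by
    intro k hk
    induction k, hk using Nat.le_induction with
    | base =>
      intro _
      refine ⟨{a}, ∅, fun _ => 0, by simp, by simp, by simp, by simp, ?_⟩
      intro u hu v hv
      rw [mem_singleton.1 hu, mem_singleton.1 hv]
      exact walkRel_hasWalk.refl _ _ (abs_nonneg _)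
    | succ k hk ih =>
      intro hkV
      obtain ⟨S, F, f, hS, hF, hFS, hf, hN⟩ := ih (by omega)
      obtain ⟨s, hs⟩ : S.Nonempty := card_pos.1 (by omega)
      obtain ⟨t, ht⟩ : ∃ t, t ∉ S := by
        by_contra! h
        have := S.eq_univ_iff_forall.2 h
        rw [this, card_univ] at hS
        omega
      obtain ⟨p⟩ := hT.preconnected s t
      obtain ⟨⟨⟨u, v⟩, huv⟩, -, hu, hv⟩ := p.exists_boundary_dart (S : Set V) hs ht
      simp only [mem_coe] at hu hv
      have hc : 0 < w s(u, v) := hw _ huv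
      set c := w s(u, v) with hcdef
      have hnew : s(u, v) ∉ F := fun h => hv (hFS _ h v (Sym2.mem_mk_right u v))
      set g : V → ℝ := fun x => if x = v then f u + c else if f x ≤ f u then f x else f x + 2 * c
        with hg
      have hgv : g v = f u + c := by simp [hg]
      have hgS : ∀ x ∈ S, g x = if f x ≤ f u then f x else f x + 2 * c := fun x hx => by
        have : x ≠ v := fun h => hv (h ▸ hx)
        simp [hg, this]
      have hvS : ∀ x ∈ S, HasWalk T w x v |g x - g v| := by
        intro x hx
        refine walkRel_hasWalk.mono _ _ _ _
          (walkRel_hasWalk.trans _ _ _ _ _ (hN x hx u hu) (HasWalk.of_adj huv)) ?_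
        rw [hgv, hgS x hx, ← hcdef]
        split_ifs with h
        · rw [abs_of_nonpos (by linarith), abs_of_nonpos (by linarith)]
          linarith
        · rw [abs_of_nonneg (by linarith), abs_of_nonneg (by linarith)]
          linarith
      refine ⟨insert v S, insert s(u, v) F, g, by rw [card_insert_of_notMem hv, hS],
        insert_subset (by simpa using huv) hF, ?_, ?_, ?_⟩
      · intro e he x hx
        rcases mem_insert.1 he with rfl | he
        · rcases Sym2.mem_iff.1 hx with rfl | rfl
          · exact mem_insert_of_mem hu
          · exact mem_insert_self _ _
        · exact mem_insert_of_mem (hFS e he x hx)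
      · rw [sum_insert hnew, ← hcdef]
        intro x hx
        have hfu := hf u hu
        rcases mem_insert.1 hx with rfl | hx
        · rw [hgv]
          constructor <;> linarith
        · have hfx := hf x hx
          rw [hgS x hx]
          split_ifs <;> constructor <;> linarith
      · intro x hx y hy
        rcases mem_insert.1 hx with hx | hx <;> rcases mem_insert.1 hy with hy | hy
        · rw [hx, hy]
          exact walkRel_hasWalk.refl _ _ (abs_nonneg _)
        · rw [hx, abs_sub_comm]
          exact walkRel_hasWalk.symm _ _ _ (hvS y hy)
        · rw [hy]
          exact hvS x hx
        · refine walkRel_hasWalk.mono _ _ _ _ (hN x hx y hy) ?_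
          rw [hgS x hx, hgS y hy]
          split_ifs <;> first
            | exact le_rfl
            | (rw [abs_of_nonpos (by linarith), abs_of_nonpos (by linarith)]; linarith)
            | (rw [abs_of_nonneg (by linarith), abs_of_nonneg (by linarith)]; linarith)
            | simp
  obtain ⟨S, F, f, hS, hF, -, hf, hN⟩ := key (Fintype.card V)
    (Fintype.card_pos_iff.2 ⟨a⟩) le_rfl
  have hmem : ∀ u, u ∈ S := fun u => by rw [(card_eq_iff_eq_univ S).1 hS]; exact mem_univ u
  refine ⟨f, fun u => (hf u (hmem u)).1, fun u => (hf u (hmem u)).2.trans ?_,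
    fun u v => hN u (hmem u) v (hmem v)⟩
  have := sum_le_sum_of_subset_of_nonneg (f := w) hF
    (fun e he _ => (hw e (by simpa using he)).le)
  rw [wWeight]
  linarith

/-- Light edge sets that, together with a spanning connected graph, approximate all distances
from a set of terminals. -/
lemma exists_light_terminal_edges (hTG : T ≤ G) (hT : T.Connected)
    (hw : ∀ e ∈ G.edgeSet, 0 < w e) {K : Finset V} (hK : K.Nonempty) :
    ∃ X : Finset (Sym2 V), (∀ e ∈ X, e ∈ G.edgeSet) ∧
      ∑ e ∈ X, w e ≤ 1200000 * wWeight T w ∧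
      ∀ H : SimpleGraph V, T ≤ H → (∀ e ∈ X, e ∈ H.edgeSet) →
        ∀ u ∈ K, ∀ v, HasWalk H w u v (40000 * (Nat.log 2 K.card + 1) * wdist G w u v) := by
  have hG : G.Connected := hT.mono hTG
  obtain ⟨f, hf0, hf1, hfN⟩ := exists_expanding_map hT
    (fun e he => hw e (SimpleGraph.edgeSet_mono hTG he))
  obtain ⟨Q, hQ, hQN⟩ := exists_light_terminal_pairs (d := wdist G w) (wdist_nonneg hw)
    (wdist_symm hG hw) (wdist_triangle hG hw)
    (fun u v => ((hfN u v).mono_graph hTG).wdist_le hw) hf0 hf1 hK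
  choose p hp using fun x : V × V => hasWalk_two_mul_wdist hG hw x.1 x.2
  have hXG : ∀ e ∈ Q.biUnion fun x => (p x).edges.toFinset, e ∈ G.edgeSet := by
    intro e he
    obtain ⟨x, -, hx⟩ := mem_biUnion.1 he
    exact (p x).edges_subset_edgeSet (List.mem_toFinset.1 hx)
  refine ⟨Q.biUnion fun x => (p x).edges.toFinset, hXG, ?_, ?_⟩
  · have h1 : ∀ x, ∑ e ∈ (p x).edges.toFinset, w e ≤ ((p x).edges.map w).sum := by
      intro x
      rw [sum_list_map_count]
      refine sum_le_sum fun e he => ?_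
      have he := List.mem_toFinset.1 he
      have h2 : 1 ≤ (p x).edges.count e := List.count_pos_iff.2 he
      have h3 := hw e ((p x).edges_subset_edgeSet he)
      rw [nsmul_eq_mul]
      have h4 : (1 : ℝ) ≤ (p x).edges.count e := by exact_mod_cast h2
      nlinarith
    have h2 : ∑ e ∈ Q.biUnion fun x => (p x).edges.toFinset, w e ≤
        ∑ x ∈ Q, ∑ e ∈ (p x).edges.toFinset, w e := by
      exact sum_biUnion_le_sum _ _ fun e he => (hw e (hXG e he)).le
    calc _ ≤ _ := h2
      _ ≤ ∑ x ∈ Q, 2 * wdist G w x.1 x.2 := sum_le_sum fun x _ => (h1 x).trans (hp x)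
      _ ≤ _ := by rw [← mul_sum]; linarith
  · intro H hTH hX u hu v
    refine hQN _ walkRel_hasWalk (fun u v => (hfN u v).mono_graph hTH) (fun x hx => ?_) u hu v
    exact walkRel_hasWalk.mono _ _ _ _ (HasWalk.of_edges_mem (p x) fun e he => hX e
      (mem_biUnion.2 ⟨x, hx, List.mem_toFinset.2 he⟩)) (hp x)

end Fintype

end Graph

lemma exists_level {j n : ℕ} (hj : j < n) :
    ∃ i < n + 1, j < 2 ^ 2 ^ i ∧ (2 : ℝ) ^ i ≤ 2 * Real.logb 2 ((j : ℝ) + 1 + 2) ∧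
      (i : ℝ) + 1 ≤ 2 * (1 + Real.logb 2 (1 + Real.logb 2 ((j : ℝ) + 1 + 2))) := by
  have hex : ∃ i, j < 2 ^ 2 ^ i :=
    ⟨n, hj.trans (Nat.lt_two_pow_self.trans (Nat.pow_lt_pow_right (by norm_num)
      Nat.lt_two_pow_self))⟩
  set L := Real.logb 2 ((j : ℝ) + 1 + 2) with hL
  have hL1 : 1 ≤ L := by
    rw [hL, Real.le_logb_iff_rpow_le (by norm_num) (by positivity)]
    have : (0 : ℝ) ≤ j := j.cast_nonneg
    norm_num
    linarith
  have hM : 0 ≤ Real.logb 2 (1 + L) := Real.logb_nonneg (by norm_num) (by linarith)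
  refine ⟨Nat.find hex, Nat.lt_succ_of_le (Nat.find_min' hex ?_), Nat.find_spec hex, ?_⟩
  · exact hj.trans (Nat.lt_two_pow_self.trans (Nat.pow_lt_pow_right (by norm_num)
      Nat.lt_two_pow_self))
  rcases hi : Nat.find hex with _ | i
  · norm_num
    constructor <;> linarith
  · have h1 : 2 ^ 2 ^ i ≤ j := not_lt.1 (Nat.find_min hex (hi ▸ Nat.lt_succ_self i))
    have h2 : (2 : ℝ) ^ i ≤ L := by
      rw [hL, Real.le_logb_iff_rpow_le (by norm_num) (by positivity)]
      have h3 : (2 : ℝ) ^ 2 ^ i ≤ j := by exact_mod_cast h1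
      have h4 : (2 : ℝ) ^ ((2 : ℝ) ^ i) = 2 ^ 2 ^ i := by
        rw [← Real.rpow_natCast 2 (2 ^ i)]
        push_cast
        rfl
      rw [h4]
      linarith
    have h3 : (i : ℝ) ≤ Real.logb 2 (1 + L) := by
      rw [Real.le_logb_iff_rpow_le (by norm_num) (by linarith), Real.rpow_natCast]
      linarith
    constructor
    · rw [pow_succ]
      linarith
    · push_cast
      linarith

lemma sum_inv_sq_le (m : ℕ) :
    ∑ i ∈ range (m + 1), 1 / ((i : ℝ) + 1) ^ 2 ≤ 2 - 1 / ((m : ℝ) + 1) := by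
  induction m with
  | zero => norm_num
  | succ m ih =>
    rw [sum_range_succ]
    have h : 1 / ((m : ℝ) + 1 + 1) ^ 2 ≤ 1 / ((m : ℝ) + 1) - 1 / ((m : ℝ) + 1 + 1) := by
      rw [div_sub_div _ _ (by positivity) (by positivity),
        div_le_div_iff₀ (by positivity) (by positivity)]
      have : (0 : ℝ) ≤ m := m.cast_nonneg
      nlinarith
    push_cast
    linarith

section Spanner

variable {V : Type*} [Fintype V] {G T : SimpleGraph V} {w : Sym2 V → ℝ}

lemma exists_isSpanningTree_wWeight_eq (hG : G.Connected) :
    ∃ T, IsSpanningTree G T ∧ wWeight T w = mstWeight G w := by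
  obtain ⟨T, hT⟩ := hG.exists_isTree_le
  have hne : {x : ℝ | ∃ T : SimpleGraph V, IsSpanningTree G T ∧ x = wWeight T w}.Nonempty :=
    ⟨_, T, hT, rfl⟩
  have hfin : {x : ℝ | ∃ T : SimpleGraph V, IsSpanningTree G T ∧ x = wWeight T w}.Finite := by
    refine (Set.finite_range fun T : SimpleGraph V => wWeight T w).subset ?_
    rintro x ⟨T, -, rfl⟩
    exact ⟨T, rfl⟩
  obtain ⟨T', hT', h⟩ := hne.csInf_mem hfin
  exact ⟨T', hT', h.symm⟩

/-- The edges outside `T` can be made lighter at the expense of a larger stretch. -/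
lemma exists_light_terminal_edges_of_pos (hTG : T ≤ G) (hT : T.Connected)
    (hw : ∀ e ∈ G.edgeSet, 0 < w e) {K : Finset V} (hK : K.Nonempty) {ρ : ℝ} (hρ : 0 < ρ)
    (hρ1 : ρ ≤ 1) :
    ∃ X : Finset (Sym2 V), (∀ e ∈ X, e ∈ G.edgeSet) ∧
      ∑ e ∈ X, w e ≤ 1200000 * ρ * wWeight T w ∧
      ∀ H : SimpleGraph V, T ≤ H → H ≤ G → (∀ e ∈ X, e ∈ H.edgeSet) →
        ∀ u ∈ K, ∀ v,
          wdist H w u v ≤ 40000 * (Nat.log 2 K.card + 1) / ρ * wdist G w u v := by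
  set w' : Sym2 V → ℝ := fun e => if e ∈ T.edgeSet then w e else w e / ρ with hw'def
  have hle : ∀ e ∈ G.edgeSet, w e ≤ w' e := by
    intro e he
    simp only [hw'def]
    split_ifs
    · exact le_rfl
    · rw [le_div_iff₀ hρ]
      nlinarith [hw e he]
  have hw' : ∀ e ∈ G.edgeSet, 0 < w' e := fun e he => (hw e he).trans_le (hle e he)
  have hle' : ∀ e ∈ G.edgeSet, w' e ≤ ρ⁻¹ * w e := by
    intro e he
    have h1 : 1 ≤ ρ⁻¹ := (one_le_inv₀ hρ).2 hρ1
    simp only [hw'def]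
    split_ifs
    · nlinarith [hw e he]
    · rw [div_eq_inv_mul]
  have hTw : wWeight T w' = wWeight T w := by
    refine sum_congr rfl fun e he => ?_
    simp only [hw'def]
    rw [if_pos (by simpa using he)]
  obtain ⟨X, hXG, hX, hXN⟩ := exists_light_terminal_edges hTG hT hw' hK
  refine ⟨X.filter (· ∉ T.edgeSet), fun e he => hXG e (mem_filter.1 he).1, ?_, ?_⟩
  · have h1 : ∑ e ∈ X.filter (· ∉ T.edgeSet), w e = ρ * ∑ e ∈ X.filter (· ∉ T.edgeSet), w' e := by
      rw [mul_sum]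
      refine sum_congr rfl fun e he => ?_
      simp only [hw'def]
      rw [if_neg (mem_filter.1 he).2]
      field_simp
    have h2 : ∑ e ∈ X.filter (· ∉ T.edgeSet), w' e ≤ ∑ e ∈ X, w' e :=
      sum_le_sum_of_subset_of_nonneg (filter_subset _ _) fun e he _ => (hw' e (hXG e he)).le
    rw [hTw] at hX
    rw [h1]
    calc _ ≤ ρ * (1200000 * wWeight T w) := by
          exact mul_le_mul_of_nonneg_left (h2.trans hX) hρ.le
      _ = _ := by ring
  · intro H hTH hHG hXH u hu v
    obtain ⟨p, hp⟩ := hXN H hTH (fun e he => by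
      by_cases h : e ∈ T.edgeSet
      · exact SimpleGraph.edgeSet_mono hTH h
      · exact hXH e (mem_filter.2 ⟨he, h⟩)) u hu v
    have hHG' := SimpleGraph.edgeSet_mono hHG
    have h1 : wdist H w u v ≤ (p.edges.map w').sum :=
      HasWalk.wdist_le (fun e he => hw e (hHG' he))
        ⟨p, weight_le_weight (fun e he => hle e (hHG' he)) p⟩
    have h2 := wdist_le_mul_wdist (hT.mono hTG) hw' (inv_pos.2 hρ) hle' u v
    calc wdist H w u v ≤ _ := h1.trans hp
      _ ≤ 40000 * (Nat.log 2 K.card + 1) * (ρ⁻¹ * wdist G w u v) := by gcongr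
      _ = _ := by ring

end Spanner

/-- There is a universal constant `C > 0` such that for every weighted
graph `G`, every `0 < ρ < 1` and every priority ranking `v_1, …, v_n` of the vertices
(here `π : Fin n ≃ V`, the vertex of rank `j` being `π (j-1)`), there is a spanner `H`
of lightness at most `1 + C·ρ` with prioritized distortion
`α(j) = (C/ρ) · log₂(j+2) · (1 + log₂(1 + log₂(j+2)))²`. -/
theorem stmt3 :
    ∃ C : ℝ, 0 < C ∧
      ∀ (V : Type) [Fintype V] (G : SimpleGraph V) (w : Sym2 V → ℝ),
        IsWeightedGraph G w →
        ∀ ρ : ℝ, 0 < ρ → ρ < 1 →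
          ∀ π : Fin (Fintype.card V) ≃ V,
            ∃ H : SimpleGraph V, IsSpanner G H ∧
              wWeight H w / mstWeight G w ≤ 1 + C * ρ ∧
              ∀ j i : Fin (Fintype.card V), j < i →
                wdist H w (π j) (π i) ≤
                  ((C / ρ) * Real.logb 2 (((j : ℕ) : ℝ) + 1 + 2) *
                      (1 + Real.logb 2 (1 + Real.logb 2 (((j : ℕ) : ℝ) + 1 + 2))) ^ 2) *
                    wdist G w (π j) (π i) := by
  refine ⟨2400000, by norm_num, ?_⟩
  rintro V _ G w ⟨hG, hw, -⟩ ρ hρ hρ1 π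
  obtain ⟨T, ⟨hTG, hT⟩, hTw⟩ := exists_isSpanningTree_wWeight_eq (w := w) hG
  have hTc : T.Connected := hT.1
  have hn0 : 0 < Fintype.card V := Fintype.card_pos_iff.2 hG.nonempty
  set K : ℕ → Finset V := fun i => univ.filter fun v => (π.symm v : ℕ) < 2 ^ 2 ^ i with hK
  have hKne : ∀ i, (K i).Nonempty := fun i => ⟨π ⟨0, hn0⟩, by simp [hK]⟩
  have hKcard : ∀ i, (K i).card ≤ 2 ^ 2 ^ i := fun i => by
    have := card_le_card_of_injOn (s := K i) (t := range (2 ^ 2 ^ i)) (fun v => (π.symm v : ℕ))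
      (fun v hv => by simpa [hK] using hv)
      (fun u _ v _ h => π.symm.injective (Fin.ext h))
    simpa using this
  have hKlog : ∀ i, (Nat.log 2 (K i).card : ℝ) ≤ 2 ^ i := fun i => by
    have h1 : Nat.log 2 (K i).card ≤ 2 ^ i := by
      have := Nat.log_mono_right (b := 2) (hKcard i)
      rwa [Nat.log_pow (by norm_num)] at this
    exact_mod_cast h1
  choose X hXG hXw hXd using fun i : ℕ => exists_light_terminal_edges_of_pos (w := w) hTG hTc hw
    (hKne i) (ρ := ρ * (1 / ((i : ℝ) + 1) ^ 2)) (by positivity) (by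
      have h1 : (0 : ℝ) ≤ i := i.cast_nonneg
      have h2 : 1 / ((i : ℝ) + 1) ^ 2 ≤ 1 := by
        rw [div_le_one (by positivity)]
        nlinarith
      have h3 : 0 ≤ 1 / ((i : ℝ) + 1) ^ 2 := by positivity
      nlinarith)
  set Y := (range (Fintype.card V + 1)).biUnion X with hY
  have hYG : ∀ e ∈ Y, e ∈ G.edgeSet := fun e he => by
    obtain ⟨i, -, hi⟩ := mem_biUnion.1 he
    exact hXG i e hi
  set H := T ⊔ SimpleGraph.fromEdgeSet (Y : Set (Sym2 V)) with hH
  have hTH : T ≤ H := le_sup_left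
  have hHe : H.edgeSet = T.edgeSet ∪ Y := by
    ext e
    simp only [hH, SimpleGraph.edgeSet_sup, SimpleGraph.edgeSet_fromEdgeSet, Set.mem_union,
      Set.mem_sdiff, mem_coe]
    refine or_congr_right ⟨And.left, fun h => ⟨h, ?_⟩⟩
    exact G.not_isDiag_of_mem_edgeSet (hYG e h)
  have hHG : H ≤ G := by
    rw [← SimpleGraph.edgeSet_subset_edgeSet, hHe]
    exact Set.union_subset (SimpleGraph.edgeSet_mono hTG) hYG
  refine ⟨H, ⟨hHG, hTc.mono hTH⟩, ?_, ?_⟩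
  · have hT0 : 0 ≤ wWeight T w := sum_nonneg fun e he =>
      (hw e (SimpleGraph.edgeSet_mono hTG (by simpa using he))).le
    have hYw : ∑ e ∈ Y, w e ≤ 2400000 * ρ * wWeight T w := by
      calc _ ≤ ∑ i ∈ range (Fintype.card V + 1), ∑ e ∈ X i, w e :=
            sum_biUnion_le_sum _ _ fun e he => (hw e (hYG e he)).le
        _ ≤ ∑ i ∈ range (Fintype.card V + 1), 1200000 * (ρ * (1 / ((i : ℝ) + 1) ^ 2)) * wWeight T w :=
            sum_le_sum fun i _ => hXw i
        _ = 1200000 * ρ * wWeight T w * ∑ i ∈ range (Fintype.card V + 1), 1 / ((i : ℝ) + 1) ^ 2 := by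
            rw [mul_sum]
            exact sum_congr rfl fun i _ => by ring
        _ ≤ 1200000 * ρ * wWeight T w * 2 := by
            refine mul_le_mul_of_nonneg_left ((sum_inv_sq_le _).trans ?_) (by positivity)
            linarith [show (0 : ℝ) ≤ 1 / ((Fintype.card V : ℝ) + 1) by positivity]
        _ = _ := by ring
    have hHw : wWeight H w ≤ wWeight T w + ∑ e ∈ Y, w e := by
      have h1 : H.edgeSet.toFinite.toFinset = T.edgeSet.toFinite.toFinset ∪ Y := by
        ext e
        simp [hHe]
      rw [wWeight, h1, wWeight]
      have h2 := sum_union_inter (s₁ := T.edgeSet.toFinite.toFinset) (s₂ := Y) (f := w)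
      have := sum_nonneg fun e (he : e ∈ T.edgeSet.toFinite.toFinset ∩ Y) =>
        (hw e (hYG e (mem_inter.1 he).2)).le
      linarith
    rw [← hTw]
    rcases hT0.eq_or_lt with h0 | h0
    · rw [← h0, div_zero]
      positivity
    · rw [div_le_iff₀ h0]
      linarith
  · intro j i _
    obtain ⟨l, hl, hjl, hl1, hl2⟩ := exists_level j.2
    have hd := hXd l H hTH hHG (fun e he => by
      rw [hHe]
      exact .inr (mem_biUnion.2 ⟨l, mem_range.2 hl, he⟩)) (π j) (by simpa [hK] using hjl) (π i)
    refine hd.trans (mul_le_mul_of_nonneg_right ?_ (wdist_nonneg hw _ _))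
    set L := Real.logb 2 (((j : ℕ) : ℝ) + 1 + 2)
    set M := 1 + Real.logb 2 (1 + L)
    have hL1 : 1 ≤ L := by
      rw [Real.le_logb_iff_rpow_le (by norm_num) (by positivity)]
      have : (0 : ℝ) ≤ (j : ℕ) := Nat.cast_nonneg _
      norm_num
      linarith
    have h1 : (Nat.log 2 (K l).card : ℝ) + 1 ≤ 3 * L := by linarith [hKlog l]
    have h2 : ((l : ℝ) + 1) ^ 2 ≤ (2 * M) ^ 2 := by gcongr
    calc _ = 40000 / ρ * ((Nat.log 2 (K l).card + 1) * ((l : ℝ) + 1) ^ 2) := by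
          field_simp
      _ ≤ 40000 / ρ * (3 * L * (2 * M) ^ 2) := by gcongr
      _ = 480000 / ρ * L * M ^ 2 := by ring
      _ ≤ _ := by gcongr; norm_num
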